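/- arXiv:2303.04686 — 11 statements merged into one kernel-verified Lean document; each statement's English description precedes it below -/
import Mathlib

section
/- Let n ≥ 1 and let α_0, …, α_n be pairwise distinct positive real numbers. Then the function λ ↦ e^{iλ} · Π_{j=0}^{n} (α_j + iλ)^{−1} is Lebesgue integrable on ℝ and (1/(2π)) · ∫_ℝ e^{iλ} · Π_{j=0}^{n} (α_j + iλ)^{−1} dλ = (−1)^n · Σ_{j=0}^{n} e^{−α_j} / Π_{l≠j} (α_j − α_l). In other words, the integral equals (−1)^n times the n-th divided difference of the function α ↦ e^{−α} at the points α_0, …, α_n. -/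
open MeasureTheory

/-- Partial fractions for `∏ j, (a j + z)⁻¹` with pairwise distinct `a j`. -/
theorem prod_inv_add_eq_sum {ι F : Type*} [Fintype ι] [DecidableEq ι] [Nonempty ι] [Field F]
    {a : ι → F} (ha : Function.Injective a) {z : F} (hz : ∀ j, a j + z ≠ 0) :
    ∏ j, (a j + z)⁻¹ = ∑ j, (∏ l ∈ Finset.univ.erase j, (a l - a j)⁻¹) * (a j + z)⁻¹ := by
  have hinj : Set.InjOn (fun j => -a j) (Finset.univ : Finset ι) :=
    fun i _ j _ h => ha (neg_injective h)
  have hne : ∀ i ∈ (Finset.univ : Finset ι), z ≠ -a i := fun i _ h => hz i (by simp [h])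
  have h := Lagrange.eval_interpolate_not_at_node (fun _ => (1 : F)) hne
  have hone : Lagrange.interpolate Finset.univ (fun j => -a j) (fun _ => (1 : F)) = 1 :=
    Lagrange.interpolate_one hinj Finset.univ_nonempty
  rw [hone, Polynomial.eval_one, Lagrange.eval_nodal] at h
  rw [Finset.prod_inv_distrib]
  refine inv_eq_of_mul_eq_one_right (Eq.trans ?_ h.symm)
  congr 1
  · exact Finset.prod_congr rfl fun j _ => by ring
  refine Finset.sum_congr rfl fun j _ => ?_
  rw [Lagrange.nodalWeight, mul_one, sub_neg_eq_add, add_comm z]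
  congr 1
  exact Finset.prod_congr rfl fun l _ => by congr 1; ring

theorem norm_inv_add_mul_I_le {a : ℝ} (ha : 0 < a) (t : ℝ) :
    ‖((a : ℂ) + t * Complex.I)⁻¹‖ ≤ (min a 1)⁻¹ * (√(1 + t ^ 2))⁻¹ := by
  have hm : 0 < min a 1 := lt_min ha one_pos
  rw [norm_inv, ← mul_inv, Complex.norm_add_mul_I]
  gcongr
  refine Real.le_sqrt_of_sq_le ?_
  rw [mul_pow, Real.sq_sqrt (by positivity)]
  have h₁ : min a 1 ^ 2 ≤ a ^ 2 := by gcongr; exact min_le_left _ _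
  have h₂ : min a 1 ^ 2 ≤ 1 := pow_le_one₀ hm.le (min_le_right _ _)
  nlinarith [sq_nonneg t]

theorem add_mul_I_ne_zero {a : ℝ} (ha : a ≠ 0) (t : ℝ) : (a : ℂ) + t * Complex.I ≠ 0 := by
  intro h
  simpa [ha] using congrArg Complex.re h

theorem integrable_prod_inv_add_mul_I {ι : Type*} [Fintype ι] (hι : 2 ≤ Fintype.card ι)
    {a : ι → ℝ} (ha : ∀ j, 0 < a j) :
    Integrable fun t : ℝ => ∏ j, ((a j : ℂ) + t * Complex.I)⁻¹ := by
  refine (integrable_inv_one_add_sq.const_mul (∏ j, (min (a j) 1)⁻¹)).mono' ?_ ?_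
  · refine (continuous_finsetProd _ fun j _ => ?_).aestronglyMeasurable
    exact (by fun_prop : Continuous fun t : ℝ => (a j : ℂ) + t * Complex.I).inv₀
      (add_mul_I_ne_zero (ha j).ne')
  · refine .of_forall fun t => ?_
    have hs : (√(1 + t ^ 2))⁻¹ ≤ 1 := inv_le_one_of_one_le₀ <|
      Real.one_le_sqrt.2 (by nlinarith [sq_nonneg t])
    calc ‖∏ j, ((a j : ℂ) + t * Complex.I)⁻¹‖
        = ∏ j, ‖((a j : ℂ) + t * Complex.I)⁻¹‖ := norm_prod _ _
      _ ≤ ∏ j, (min (a j) 1)⁻¹ * (√(1 + t ^ 2))⁻¹ :=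
          Finset.prod_le_prod (fun _ _ => norm_nonneg _) fun j _ => norm_inv_add_mul_I_le (ha j) t
      _ = (∏ j, (min (a j) 1)⁻¹) * (√(1 + t ^ 2))⁻¹ ^ Fintype.card ι := by
          rw [Finset.prod_mul_distrib, Finset.prod_const, Finset.card_univ]
      _ ≤ (∏ j, (min (a j) 1)⁻¹) * (√(1 + t ^ 2))⁻¹ ^ 2 := by
          have : 0 ≤ ∏ j, (min (a j) 1)⁻¹ := Finset.prod_nonneg fun j _ =>
            inv_nonneg.2 (le_min (ha j).le zero_le_one)
          exact mul_le_mul_of_nonneg_left (pow_le_pow_of_le_one (by positivity) hs hι) this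
      _ = (∏ j, (min (a j) 1)⁻¹) * (1 + t ^ 2)⁻¹ := by
          rw [inv_pow, Real.sq_sqrt (by positivity)]

/-- The function equal to `x ↦ exp (-a x)` for `x > 0` and to `0` elsewhere. -/
noncomputable def expTail (a : ℝ) : ℝ → ℂ :=
  (Set.Ioi 0).indicator fun x => Complex.exp (-a * x)

theorem integrable_expTail {a : ℝ} (ha : 0 < a) : Integrable (expTail a) :=
  (integrable_indicator_iff measurableSet_Ioi).2 <|
    integrableOn_exp_mul_complex_Ioi (by simpa using ha) 0

theorem fourier_expTail {a : ℝ} (ha : 0 < a) (ξ : ℝ) :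
    FourierTransform.fourier (expTail a) ξ = ((a : ℂ) + (2 * Real.pi * ξ : ℝ) * Complex.I)⁻¹ := by
  have h := integral_exp_mul_complex_Ioi
    (a := -(a + (2 * Real.pi * ξ : ℝ) * Complex.I)) (by simpa using ha) 0
  rw [Complex.ofReal_zero, mul_zero, Complex.exp_zero, neg_div_neg_eq, one_div] at h
  rw [← h, Real.fourier_real_eq_integral_exp_smul, ← integral_indicator measurableSet_Ioi]
  refine integral_congr_ae (.of_forall fun x => ?_)
  by_cases hx : x ∈ Set.Ioi (0 : ℝ)
  · simp only [expTail, Set.indicator_of_mem hx, smul_eq_mul, ← Complex.exp_add]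
    congr 1
    push_cast
    ring
  · simp only [expTail, Set.indicator_of_notMem hx, smul_zero]

theorem continuousAt_expTail_one (a : ℝ) : ContinuousAt (expTail a) 1 := by
  refine ContinuousAt.congr (f := fun x : ℝ => Complex.exp (-a * x)) (by fun_prop) ?_
  filter_upwards [Ioi_mem_nhds (zero_lt_one' ℝ)] with x hx
  simp only [expTail, Set.indicator_of_mem hx]

/-- For `n ≥ 1` and pairwise distinct positive reals `α_0, …, α_n`, the function
`λ ↦ e^{iλ} Π_j (α_j + iλ)^{−1}` is integrable on `ℝ` and
`(1/(2π)) ∫_ℝ e^{iλ} Π_j (α_j + iλ)^{−1} dλ = (−1)^n Σ_j e^{−α_j}/Π_{l≠j}(α_j − α_l)`. -/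
theorem stmt_4 (n : ℕ) (hn : 1 ≤ n) (α : Fin (n + 1) → ℝ)
    (hpos : ∀ j, 0 < α j) (hinj : Function.Injective α) :
    Integrable (fun t : ℝ =>
      Complex.exp (t * Complex.I) * ∏ j, ((α j : ℂ) + t * Complex.I)⁻¹) ∧
    (1 / (2 * Real.pi) : ℂ) *
        ∫ t : ℝ, Complex.exp (t * Complex.I) * ∏ j, ((α j : ℂ) + t * Complex.I)⁻¹
      = (-1) ^ n * ∑ j, Complex.exp (-(α j : ℂ)) /
          ∏ l ∈ Finset.univ.erase j, ((α j : ℂ) - (α l : ℂ)) := by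
  have hint : Integrable fun t : ℝ => ∏ j, ((α j : ℂ) + t * Complex.I)⁻¹ :=
    integrable_prod_inv_add_mul_I (by simpa using hn) hpos
  refine ⟨hint.bdd_mul (c := 1) (by fun_prop)
    (.of_forall fun t => (Complex.norm_exp_ofReal_mul_I t).le), ?_⟩
  let w : Fin (n + 1) → ℂ := fun j => ∏ l ∈ Finset.univ.erase j, ((α l : ℂ) - α j)⁻¹
  let f : ℝ → ℂ := fun x => ∑ j, w j * expTail (α j) x
  have hf : Integrable f :=
    integrable_finsetSum _ fun j _ => (integrable_expTail (hpos j)).const_mul _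
  have hcont : ContinuousAt f 1 :=
    tendsto_finsetSum _ fun j _ => (continuousAt_expTail_one (α j)).const_mul (w j)
  have hfourier : FourierTransform.fourier f =
      fun ξ : ℝ => ∏ j, ((α j : ℂ) + (2 * Real.pi * ξ : ℝ) * Complex.I)⁻¹ := by
    ext ξ
    rw [prod_inv_add_eq_sum (a := fun j => (α j : ℂ)) (Complex.ofReal_injective.comp hinj)
      fun j => add_mul_I_ne_zero (hpos j).ne' _]
    simp only [← fourier_expTail (hpos _), Real.fourier_real_eq, f, Finset.smul_sum]
    rw [integral_finsetSum]
    · refine Finset.sum_congr rfl fun j _ => ?_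
      rw [← integral_const_mul]
      exact integral_congr_ae (.of_forall fun x => (mul_smul_comm _ _ _).symm)
    · intro j _
      simpa [mul_comm ξ] using (Real.fourierIntegral_convergent_iff ξ).2
        ((integrable_expTail (hpos j)).const_mul (w j))
  have hinv := hf.fourierInv_fourier_eq
    (by rw [hfourier]; exact hint.comp_mul_left' (by positivity)) hcont
  have hvalue : f 1 = (-1) ^ n * ∑ j, Complex.exp (-(α j : ℂ)) /
      ∏ l ∈ Finset.univ.erase j, ((α j : ℂ) - (α l : ℂ)) := by
    rw [Finset.mul_sum]
    refine Finset.sum_congr rfl fun j _ => ?_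
    have hw : w j = (-1) ^ n * (∏ l ∈ Finset.univ.erase j, ((α j : ℂ) - (α l : ℂ)))⁻¹ := by
      have hsign : (-1 : ℂ) ^ n = ∏ _l ∈ Finset.univ.erase j, (-1 : ℂ) := by simp
      rw [← Finset.prod_inv_distrib, hsign, ← Finset.prod_mul_distrib]
      refine Finset.prod_congr rfl fun l _ => ?_
      rw [← neg_sub, inv_neg, neg_one_mul]
    simp only [hw, expTail, Set.indicator_of_mem (Set.mem_Ioi.2 zero_lt_one), Complex.ofReal_one,
      mul_one]
    ring
  rw [← hvalue, ← hinv, Real.fourierInv_eq', hfourier]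
  have hscale := Measure.integral_comp_mul_left (fun t : ℝ =>
    Complex.exp (t * Complex.I) * ∏ j, ((α j : ℂ) + t * Complex.I)⁻¹) (2 * Real.pi)
  rw [abs_of_pos (by positivity), Complex.real_smul] at hscale
  convert hscale.symm using 1
  · push_cast
    rw [one_div]
  · simp
end

section
/- Let d ≥ 2 and n ≥ 1 be integers and let k be an even integer with 0 ≤ k ≤ 2n. Let f : ℝ → ℂ be a Schwartz function, let α_0, …, α_n be pairwise distinct positive reals, and let F : (0,∞) → ℂ be any function with F^{(k/2)}(α) = α^{−d/2} for all α > 0. Then the function s ↦ |s|^{−k} · Σ_{j=0}^{n} f(|s|²·α_j)/Π_{l≠j}(α_j − α_l) is Lebesgue integrable on ℝ^d and ∫_{ℝ^d} |s|^{−k} · Σ_{j=0}^{n} f(|s|²·α_j)/Π_{l≠j}(α_j − α_l) ds = ( ∫_{ℝ^d} f^{(k/2)}(|s|²) ds ) · Σ_{j=0}^{n} F(α_j)/Π_{l≠j}(α_j − α_l). -/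
open MeasureTheory
open scoped Nat

/-- Taylor's formula with integral remainder, in terms of `iteratedDeriv`. -/
theorem taylor_integral_remainder_iteratedDeriv {h : ℝ → ℂ} {c x : ℝ} {p : ℕ} (hcx : c < x)
    (hh : ∀ t ∈ Set.Icc c x, ContDiffAt ℝ (p + 1 : ℕ) h t) :
    h x = ∑ i ∈ Finset.range (p + 1), ((i ! : ℝ)⁻¹ * (x - c) ^ i) • iteratedDeriv i h c +
      ∫ t in c..x, ((x - t) ^ p / p !) • iteratedDeriv (p + 1) h t := by
  have hun : UniqueDiffOn ℝ (Set.Icc c x) := uniqueDiffOn_Icc hcx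
  have hsub := taylor_integral_remainder (f := h) (x := x) (x₀ := c) (n := p) (by
    rw [Set.uIcc_of_le hcx.le]
    exact fun t ht => (hh t ht).contDiffWithinAt)
  rw [Set.uIcc_of_le hcx.le, taylor_within_apply, sub_eq_iff_eq_add'] at hsub
  rw [hsub]
  congr 1
  · refine Finset.sum_congr rfl fun i hi => ?_
    rw [iteratedDerivWithin_eq_iteratedDeriv hun _ (Set.left_mem_Icc.2 hcx.le)]
    refine (hh c (Set.left_mem_Icc.2 hcx.le)).of_le ?_
    exact_mod_cast (Finset.mem_range.1 hi).le
  · refine intervalIntegral.integral_congr fun t ht => ?_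
    rw [Set.uIcc_of_le hcx.le] at ht
    rw [iteratedDerivWithin_eq_iteratedDeriv hun (hh t ht) ht]

/-- Divided differences of order `n` annihilate the powers of degree less than `n`. -/
theorem sum_sub_pow_div_prod_eq_zero {n i : ℕ} (hi : i < n) {α : Fin (n + 1) → ℝ}
    (hinj : Function.Injective α) (c : ℝ) :
    ∑ j, (α j - c) ^ i / ∏ l ∈ Finset.univ.erase j, (α j - α l) = 0 := by
  have hdeg : ((Polynomial.X - Polynomial.C c) ^ i).degree = (i : WithBot ℕ) := by
    rw [Polynomial.degree_pow, Polynomial.degree_X_sub_C]; simp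
  have h := Lagrange.coeff_eq_sum (s := Finset.univ) (v := α) hinj.injOn
    (P := (Polynomial.X - Polynomial.C c) ^ i) (by
      rw [hdeg, Finset.card_univ, Fintype.card_fin]; exact_mod_cast hi.trans n.lt_succ_self)
  rw [Polynomial.coeff_eq_zero_of_degree_lt] at h
  · simpa using h.symm
  · rw [hdeg, Finset.card_univ, Fintype.card_fin]; exact_mod_cast hi

/-- Integral representation of a divided difference of order `n` through a derivative of order
at most `n`. -/
theorem sum_div_prod_eq_sum_integral {n p : ℕ} (hp : p < n) {α : Fin (n + 1) → ℝ}
    (hinj : Function.Injective α) {c : ℝ} (hc : ∀ j, c < α j) {h : ℝ → ℂ}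
    (hh : ∀ t, c ≤ t → ContDiffAt ℝ (p + 1 : ℕ) h t) :
    ∑ j, h (α j) / ((∏ l ∈ Finset.univ.erase j, (α j - α l) : ℝ) : ℂ) =
      ∑ j, (∫ t in c..α j, ((α j - t) ^ p / p !) • iteratedDeriv (p + 1) h t) /
        ((∏ l ∈ Finset.univ.erase j, (α j - α l) : ℝ) : ℂ) := by
  have key : ∀ j, h (α j) / ((∏ l ∈ Finset.univ.erase j, (α j - α l) : ℝ) : ℂ) =
      (∑ i ∈ Finset.range (p + 1),
        (((α j - c) ^ i / ∏ l ∈ Finset.univ.erase j, (α j - α l) : ℝ) : ℂ) *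
          ((i ! : ℂ)⁻¹ * iteratedDeriv i h c)) +
      (∫ t in c..α j, ((α j - t) ^ p / p !) • iteratedDeriv (p + 1) h t) /
        ((∏ l ∈ Finset.univ.erase j, (α j - α l) : ℝ) : ℂ) := by
    intro j
    rw [taylor_integral_remainder_iteratedDeriv (hc j) fun t ht => hh t ht.1, add_div,
      Finset.sum_div]
    congr 1
    refine Finset.sum_congr rfl fun i _ => ?_
    rw [Complex.real_smul, Complex.ofReal_div]
    push_cast
    ring
  rw [Finset.sum_congr rfl fun j _ => key j, Finset.sum_add_distrib, Finset.sum_comm,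
    Finset.sum_eq_zero, zero_add]
  intro i hi
  rw [← Finset.sum_mul, ← Complex.ofReal_sum,
    sum_sub_pow_div_prod_eq_zero (by have := Finset.mem_range.1 hi; lia) hinj c]
  simp

theorem SchwartzMap.exists_coe_eq_iteratedDeriv (f : SchwartzMap ℝ ℂ) (m : ℕ) :
    ∃ g : SchwartzMap ℝ ℂ, ⇑g = iteratedDeriv m f := by
  induction m with
  | zero => exact ⟨f, by simp⟩
  | succ m ih =>
    obtain ⟨g, hg⟩ := ih
    exact ⟨SchwartzMap.derivCLM ℝ ℂ g, by ext x; rw [iteratedDeriv_succ, ← hg]; simp⟩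

theorem SchwartzMap.exists_norm_apply_sq_mul_le (g : SchwartzMap ℝ ℂ) (d : ℕ) {c : ℝ}
    (hc : 0 < c) :
    ∃ C : ℝ, ∀ r t : ℝ, c ≤ t → ‖g (r ^ 2 * t)‖ ≤ C * (1 + r ^ 2) ^ (-(2 * d : ℝ) / 2) := by
  obtain ⟨A, hA⟩ : ∃ A : ℝ, ∀ x : ℝ, (1 + ‖x‖) ^ d * ‖g x‖ ≤ A := by
    have h := SchwartzMap.one_add_le_sup_seminorm_apply (𝕜 := ℝ) (m := (d, 0)) le_rfl le_rfl g
    simp only [norm_iteratedFDeriv_zero] at h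
    exact ⟨_, h⟩
  have hb : 0 < min 1 c := lt_min one_pos hc
  refine ⟨A / min 1 c ^ d, fun r t ht => ?_⟩
  have ht0 : 0 < t := hc.trans_le ht
  have hle : min 1 c * (1 + r ^ 2) ≤ 1 + ‖r ^ 2 * t‖ := by
    rw [Real.norm_of_nonneg (by positivity)]
    nlinarith [min_le_left 1 c, min_le_right 1 c, sq_nonneg r]
  have hexp : (1 + r ^ 2) ^ (-(2 * d : ℝ) / 2) = ((1 + r ^ 2) ^ d)⁻¹ := by
    rw [show (-(2 * d : ℝ) / 2) = -(d : ℝ) by ring, Real.rpow_neg (by positivity),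
      Real.rpow_natCast]
  rw [hexp, ← div_eq_mul_inv, div_div, ← mul_pow, le_div_iff₀ (by positivity), mul_comm]
  exact (mul_le_mul_of_nonneg_right (pow_le_pow_left₀ (by positivity) hle d)
    (norm_nonneg _)).trans (hA _)

section Radial

variable {d : ℕ}

theorem integrable_one_add_norm_sq_rpow (hd : 2 ≤ d) :
    Integrable fun s : EuclideanSpace ℝ (Fin d) => (1 + ‖s‖ ^ 2) ^ (-(2 * d : ℝ) / 2) := by
  refine integrable_rpow_neg_one_add_norm_sq ?_
  rw [finrank_euclideanSpace_fin]
  have : (2 : ℝ) ≤ d := by exact_mod_cast hd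
  linarith

theorem SchwartzMap.integrable_apply_norm_sq_mul (hd : 2 ≤ d) (g : SchwartzMap ℝ ℂ) {t : ℝ}
    (ht : 0 < t) :
    Integrable fun s : EuclideanSpace ℝ (Fin d) => g (‖s‖ ^ 2 * t) := by
  obtain ⟨C, hC⟩ := g.exists_norm_apply_sq_mul_le d ht
  refine ((integrable_one_add_norm_sq_rpow hd).const_mul C).mono' ?_ ?_
  · exact (g.continuous.comp (by fun_prop)).aestronglyMeasurable
  · exact .of_forall fun s => hC _ _ le_rfl

theorem integral_comp_norm_sq_mul (g : ℝ → ℂ) {t : ℝ} (ht : 0 < t) :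
    ∫ s : EuclideanSpace ℝ (Fin d), g (‖s‖ ^ 2 * t) =
      ((t ^ (-(d : ℝ) / 2) : ℝ) : ℂ) * ∫ s : EuclideanSpace ℝ (Fin d), g (‖s‖ ^ 2) := by
  have h := Measure.integral_comp_smul (volume : Measure (EuclideanSpace ℝ (Fin d)))
    (fun s => g (‖s‖ ^ 2)) (√t)
  simp only [norm_smul, mul_pow, Real.norm_eq_abs, sq_abs, Real.sq_sqrt ht.le,
    finrank_euclideanSpace_fin] at h
  simp only [mul_comm _ t]
  rw [h, Complex.real_smul, abs_of_nonneg (by positivity), Real.sqrt_eq_rpow, ← Real.rpow_natCast,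
    ← Real.rpow_mul ht.le, ← Real.rpow_neg ht.le]
  congr 4
  ring

theorem SchwartzMap.integrable_prod_smul_apply_norm_sq_mul (hd : 2 ≤ d) (g : SchwartzMap ℝ ℂ)
    {c : ℝ} (hc : 0 < c) (x : ℝ) {κ : ℝ → ℝ} (hκ : Continuous κ) :
    Integrable (fun q : EuclideanSpace ℝ (Fin d) × ℝ => κ q.2 • g (‖q.1‖ ^ 2 * q.2))
      (volume.prod (volume.restrict (Set.Ioc c x))) := by
  obtain ⟨C, hC⟩ := g.exists_norm_apply_sq_mul_le d hc
  have hκi : Integrable (fun t => ‖κ t‖) (volume.restrict (Set.Ioc c x)) :=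
    (hκ.norm.integrableOn_Icc (a := c) (b := x)).mono_set Set.Ioc_subset_Icc_self
  refine (((integrable_one_add_norm_sq_rpow hd).const_mul C).mul_prod hκi).mono' ?_ ?_
  · exact ((hκ.comp continuous_snd).smul
      (g.continuous.comp (by fun_prop))).aestronglyMeasurable
  · have hmeas : (volume : Measure (EuclideanSpace ℝ (Fin d))).prod
        (volume.restrict (Set.Ioc c x)) =
        (volume.prod volume).restrict (Set.univ ×ˢ Set.Ioc c x) := by
      rw [← Measure.prod_restrict, Measure.restrict_univ]
    rw [hmeas, ae_restrict_iff' (MeasurableSet.univ.prod measurableSet_Ioc)]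
    refine .of_forall fun q hq => ?_
    rw [norm_smul, mul_comm]
    exact mul_le_mul_of_nonneg_right (hC _ _ hq.2.1.le) (norm_nonneg _)

theorem SchwartzMap.integrable_intervalIntegral_norm_sq_mul (hd : 2 ≤ d) (g : SchwartzMap ℝ ℂ)
    {c x : ℝ} (hc : 0 < c) (hcx : c ≤ x) {κ : ℝ → ℝ} (hκ : Continuous κ) :
    Integrable fun s : EuclideanSpace ℝ (Fin d) =>
      ∫ t in c..x, κ t • g (‖s‖ ^ 2 * t) := by
  simp only [intervalIntegral.integral_of_le hcx]
  exact (g.integrable_prod_smul_apply_norm_sq_mul hd hc x hκ).integral_prod_left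

theorem SchwartzMap.integral_intervalIntegral_norm_sq_mul (hd : 2 ≤ d) (g : SchwartzMap ℝ ℂ)
    {c x : ℝ} (hc : 0 < c) (hcx : c ≤ x) {κ : ℝ → ℝ} (hκ : Continuous κ) :
    ∫ s : EuclideanSpace ℝ (Fin d), ∫ t in c..x, κ t • g (‖s‖ ^ 2 * t) =
      (∫ s : EuclideanSpace ℝ (Fin d), g (‖s‖ ^ 2)) *
        ∫ t in c..x, κ t • ((t ^ (-(d : ℝ) / 2) : ℝ) : ℂ) := by
  simp only [intervalIntegral.integral_of_le hcx]
  rw [integral_integral_swap (g.integrable_prod_smul_apply_norm_sq_mul hd hc x hκ),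
    ← integral_const_mul]
  refine setIntegral_congr_fun measurableSet_Ioc fun t ht => ?_
  rw [integral_smul, integral_comp_norm_sq_mul g (hc.trans ht.1), mul_smul_comm, mul_comm]

end Radial

/-- Let `d ≥ 2`, `n ≥ 1`, `k` even with `0 ≤ k ≤ 2n`, `f : ℝ → ℂ` Schwartz,
`α_0, …, α_n` pairwise distinct positive reals, and `F` any `(k/2)`-th order primitive of
`α ↦ α^{−d/2}` on `(0,∞)`. Then `s ↦ |s|^{−k} Σ_j f(|s|²α_j)/Π_{l≠j}(α_j − α_l)` is
integrable on `ℝ^d` and its integral equals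
`(∫ f^{(k/2)}(|s|²) ds) · Σ_j F(α_j)/Π_{l≠j}(α_j − α_l)`. -/
theorem stmt_5 (d n k : ℕ) (hd : 2 ≤ d) (hn : 1 ≤ n) (hk : Even k) (hkn : k ≤ 2 * n)
    (f : SchwartzMap ℝ ℂ) (α : Fin (n + 1) → ℝ)
    (hpos : ∀ j, 0 < α j) (hinj : Function.Injective α)
    (F : ℝ → ℂ) (hFsmooth : ContDiffOn ℝ ((k / 2 : ℕ) : ℕ∞) F (Set.Ioi 0))
    (hF : ∀ x : ℝ, 0 < x →
      iteratedDerivWithin (k / 2) F (Set.Ioi 0) x = ((x ^ (-(d : ℝ) / 2) : ℝ) : ℂ)) :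
    Integrable (fun s : EuclideanSpace ℝ (Fin d) =>
      (‖s‖ ^ k)⁻¹ • ∑ j, f (‖s‖ ^ 2 * α j) /
        ((∏ l ∈ Finset.univ.erase j, (α j - α l) : ℝ) : ℂ)) ∧
    ∫ s : EuclideanSpace ℝ (Fin d),
        (‖s‖ ^ k)⁻¹ • ∑ j, f (‖s‖ ^ 2 * α j) /
          ((∏ l ∈ Finset.univ.erase j, (α j - α l) : ℝ) : ℂ)
      = (∫ s : EuclideanSpace ℝ (Fin d), iteratedDeriv (k / 2) (⇑f) (‖s‖ ^ 2)) *
          ∑ j, F (α j) / ((∏ l ∈ Finset.univ.erase j, (α j - α l) : ℝ) : ℂ) := by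
  obtain ⟨m, rfl⟩ := hk.two_dvd
  rw [Nat.mul_div_cancel_left m two_pos] at hFsmooth hF ⊢
  -- It suffices to treat the summands of a representation that is integrable termwise.
  suffices H : ∃ (u : Fin (n + 1) → EuclideanSpace ℝ (Fin d) → ℂ) (v : Fin (n + 1) → ℂ),
      (∀ j, Integrable (u j)) ∧
      (∀ j, ∫ s, u j s =
        (∫ s : EuclideanSpace ℝ (Fin d), iteratedDeriv m (⇑f) (‖s‖ ^ 2)) * v j) ∧
      (∀ s ≠ 0, (‖s‖ ^ (2 * m))⁻¹ • ∑ j, f (‖s‖ ^ 2 * α j) /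
          ((∏ l ∈ Finset.univ.erase j, (α j - α l) : ℝ) : ℂ) =
        ∑ j, u j s / ((∏ l ∈ Finset.univ.erase j, (α j - α l) : ℝ) : ℂ)) ∧
      ∑ j, F (α j) / ((∏ l ∈ Finset.univ.erase j, (α j - α l) : ℝ) : ℂ) =
        ∑ j, v j / ((∏ l ∈ Finset.univ.erase j, (α j - α l) : ℝ) : ℂ) by
    obtain ⟨u, v, hu, hint, hrep, hv⟩ := H
    have : Nonempty (Fin d) := ⟨⟨0, by lia⟩⟩
    have hae : (fun s : EuclideanSpace ℝ (Fin d) =>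
        (‖s‖ ^ (2 * m))⁻¹ • ∑ j, f (‖s‖ ^ 2 * α j) /
          ((∏ l ∈ Finset.univ.erase j, (α j - α l) : ℝ) : ℂ)) =ᵐ[volume]
        fun s => ∑ j, u j s / ((∏ l ∈ Finset.univ.erase j, (α j - α l) : ℝ) : ℂ) :=
      (Measure.ae_ne volume 0).mono hrep
    have hdiv : ∀ j, Integrable fun s =>
        u j s / ((∏ l ∈ Finset.univ.erase j, (α j - α l) : ℝ) : ℂ) :=
      fun j => (hu j).div_const _
    refine ⟨(integrable_finsetSum _ fun j _ => hdiv j).congr hae.symm, ?_⟩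
    rw [integral_congr_ae hae, integral_finsetSum _ fun j _ => hdiv j, hv, Finset.mul_sum]
    refine Finset.sum_congr rfl fun j _ => ?_
    rw [integral_div, hint, mul_div_assoc]
  cases m with
  | zero =>
    refine ⟨fun j s => f (‖s‖ ^ 2 * α j), fun j => F (α j), fun j =>
      f.integrable_apply_norm_sq_mul hd (hpos j), fun j => ?_, fun s _ => by simp, rfl⟩
    have hFj := hF (α j) (hpos j)
    rw [iteratedDerivWithin_zero] at hFj
    rw [integral_comp_norm_sq_mul _ (hpos j), ← hFj, iteratedDeriv_zero, mul_comm]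
  | succ p =>
    obtain ⟨g, hg⟩ := f.exists_coe_eq_iteratedDeriv (p + 1)
    obtain ⟨c, hc, hcα⟩ : ∃ c : ℝ, 0 < c ∧ ∀ j, c < α j := by
      obtain ⟨i, hi⟩ := Finite.exists_min α
      exact ⟨α i / 2, half_pos (hpos i), fun j => (half_lt_self (hpos i)).trans_le (hi j)⟩
    have hκ : ∀ j, Continuous fun t : ℝ => (α j - t) ^ p / (p ! : ℝ) := fun j => by fun_prop
    refine ⟨fun j s => ∫ t in c..α j, ((α j - t) ^ p / p !) • g (‖s‖ ^ 2 * t),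
      fun j => ∫ t in c..α j, ((α j - t) ^ p / p !) • ((t ^ (-(d : ℝ) / 2) : ℝ) : ℂ),
      fun j => g.integrable_intervalIntegral_norm_sq_mul hd hc (hcα j).le (hκ j),
      fun j => ?_, fun s hs => ?_, ?_⟩
    · rw [← hg]
      exact g.integral_intervalIntegral_norm_sq_mul hd hc (hcα j).le (hκ j)
    · have hf : ContDiff ℝ (p + 1 : ℕ) f := f.smooth _
      have hscale : iteratedDeriv (p + 1) (fun t => f (‖s‖ ^ 2 * t)) =
          fun t => ‖s‖ ^ (2 * (p + 1)) • g (‖s‖ ^ 2 * t) := by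
        have := iteratedDeriv_comp_const_smul hf (‖s‖ ^ 2)
        simpa only [smul_eq_mul, ← hg, ← pow_mul] using this
      have hs' : ‖s‖ ^ (2 * (p + 1)) ≠ 0 := pow_ne_zero _ (norm_ne_zero_iff.2 hs)
      rw [sum_div_prod_eq_sum_integral (h := fun t => f (‖s‖ ^ 2 * t)) (by lia) hinj hcα
        fun t _ => (hf.comp (by fun_prop)).contDiffAt, hscale, Finset.smul_sum]
      refine Finset.sum_congr rfl fun j _ => ?_
      simp only [smul_comm _ (‖s‖ ^ (2 * (p + 1)))]
      rw [intervalIntegral.integral_smul, smul_div_assoc, inv_smul_smul₀ hs']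
    · rw [sum_div_prod_eq_sum_integral (h := F) (by lia) hinj hcα fun t ht =>
        hFsmooth.contDiffAt (Ioi_mem_nhds (hc.trans_le ht))]
      refine Finset.sum_congr rfl fun j _ => ?_
      congr 1
      refine intervalIntegral.integral_congr fun t ht => ?_
      rw [Set.uIcc_of_le (hcα j).le] at ht
      have ht0 : 0 < t := hc.trans_le ht.1
      rw [← hF t ht0, iteratedDerivWithin_of_isOpen isOpen_Ioi ht0]
end

section
/- Let d ≥ 2 be an integer, let f : ℝ → ℂ be a Schwartz function, let 0 < a < b be reals, and let n ∈ ℕ, k ∈ ℤ≥0 satisfy 2n ≥ k. Then the function s ↦ |s|^{2n−k−1} · ( ∫_{a|s|²}^{b|s|²} |f^{(n)}(u)|² du )^{1/2} + |s|^{2n−k+1} · ( ∫_{a|s|²}^{b|s|²} |f^{(n+1)}(u)|² du )^{1/2}, defined for s ∈ ℝ^d \ {0}, is Lebesgue integrable on ℝ^d. -/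
open MeasureTheory

/-- The derivatives of a Schwartz function on `ℝ` decay faster than any power of `1 + |u|`. -/
lemma SchwartzMap.exists_one_add_pow_mul_norm_iteratedDeriv_le {F : Type*}
    [NormedAddCommGroup F] [NormedSpace ℝ F] (f : SchwartzMap ℝ F) (m N : ℕ) :
    ∃ C, ∀ u, (1 + |u|) ^ N * ‖iteratedDeriv m f u‖ ≤ C := by
  simp_rw [← norm_iteratedFDeriv_eq_norm_iteratedDeriv, ← Real.norm_eq_abs]
  exact ⟨_, SchwartzMap.one_add_le_sup_seminorm_apply (𝕜 := ℝ) (m := (N, m)) le_rfl le_rfl f⟩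

/-- The `L²` norm of `g` on `[a t², b t²]` is at most `√(b - a) t` times a bound for `g` there. -/
lemma Real.sqrt_intervalIntegral_norm_sq_le {F : Type*} [NormedAddCommGroup F] {g : ℝ → F}
    {a b t M : ℝ} (hab : a ≤ b) (ht : 0 ≤ t) (hM : 0 ≤ M)
    (hg : ∀ u, a * t ^ 2 ≤ u → ‖g u‖ ≤ M) :
    √(∫ u in (a * t ^ 2)..(b * t ^ 2), ‖g u‖ ^ 2) ≤ √(b - a) * t * M := by
  have hle : a * t ^ 2 ≤ b * t ^ 2 := by gcongr
  have hint : ∫ u in (a * t ^ 2)..(b * t ^ 2), ‖g u‖ ^ 2 ≤ M ^ 2 * (b * t ^ 2 - a * t ^ 2) := by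
    refine (le_abs_self _).trans ?_
    rw [← Real.norm_eq_abs, ← abs_of_nonneg (sub_nonneg.2 hle)]
    refine intervalIntegral.norm_integral_le_of_norm_le_const fun u hu ↦ ?_
    rw [Set.uIoc_of_le hle] at hu
    rw [norm_pow, norm_norm]
    gcongr
    exact hg u hu.1.le
  refine Real.sqrt_le_iff.2 ⟨by positivity, hint.trans_eq ?_⟩
  rw [mul_pow, mul_pow, Real.sq_sqrt (sub_nonneg.2 hab)]
  ring

/-- For a Schwartz function `f` on `ℝ` and `-1 ≤ p`, the function
`s ↦ ‖s‖ ^ p * ‖f⁽ᵐ⁾‖_{L²(a‖s‖², b‖s‖²)}` is integrable. -/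
lemma SchwartzMap.integrable_norm_rpow_mul_sqrt_intervalIntegral {E F : Type*}
    [NormedAddCommGroup E] [NormedSpace ℝ E] [FiniteDimensional ℝ E] [MeasurableSpace E]
    [BorelSpace E] (μ : Measure E) [μ.IsAddHaarMeasure]
    [NormedAddCommGroup F] [NormedSpace ℝ F] (f : SchwartzMap ℝ F) (m : ℕ)
    {a b p : ℝ} (ha : 0 < a) (hab : a ≤ b) (hp : -1 ≤ p) :
    Integrable (fun s : E ↦ ‖s‖ ^ p *
      √(∫ u in (a * ‖s‖ ^ 2)..(b * ‖s‖ ^ 2), ‖iteratedDeriv m f u‖ ^ 2)) μ := by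
  obtain ⟨N, hN⟩ := exists_nat_gt (p + 1 + Module.finrank ℝ E)
  obtain ⟨C, hC⟩ := f.exists_one_add_pow_mul_norm_iteratedDeriv_le m N
  have hC0 : 0 ≤ C := le_trans (by positivity) (hC 0)
  have hcont : Continuous (fun u ↦ ‖iteratedDeriv m f u‖ ^ 2) :=
    ((f.smooth m).continuous_iteratedDeriv m le_rfl).norm.pow 2
  have hprim : Continuous (fun x ↦ ∫ u in (0 : ℝ)..x, ‖iteratedDeriv m f u‖ ^ 2) :=
    intervalIntegral.continuous_primitive (fun _ _ ↦ hcont.intervalIntegrable _ _) 0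
  have hmeas : Continuous (fun s : E ↦
      ∫ u in (a * ‖s‖ ^ 2)..(b * ‖s‖ ^ 2), ‖iteratedDeriv m f u‖ ^ 2) := by
    have hsub (s : E) : ∫ u in (a * ‖s‖ ^ 2)..(b * ‖s‖ ^ 2), ‖iteratedDeriv m f u‖ ^ 2 =
        (∫ u in (0 : ℝ)..(b * ‖s‖ ^ 2), ‖iteratedDeriv m f u‖ ^ 2) -
          ∫ u in (0 : ℝ)..(a * ‖s‖ ^ 2), ‖iteratedDeriv m f u‖ ^ 2 :=
      (intervalIntegral.integral_interval_sub_left (hcont.intervalIntegrable _ _)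
        (hcont.intervalIntegrable _ _)).symm
    simp_rw [hsub]
    exact (hprim.comp (by fun_prop)).sub (hprim.comp (by fun_prop))
  set K : ℝ := 2 + 2 / a with hK
  have hK0 : 0 < K := by positivity
  have hdim : (Module.finrank ℝ E : ℝ) < 2 * N - (p + 1) := by
    have : (0 : ℝ) ≤ N := by positivity
    linarith
  refine ((integrable_one_add_norm (μ := μ) hdim).const_mul (√(b - a) * (C * K ^ N))).mono'
    ((measurable_norm.pow_const p).mul hmeas.measurable.sqrt).aestronglyMeasurable
    (.of_forall fun s ↦ ?_)
  obtain ⟨t, ht⟩ : ∃ t, t = ‖s‖ := ⟨_, rfl⟩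
  have ht0 : 0 ≤ t := ht ▸ norm_nonneg s
  rw [Real.norm_of_nonneg (by positivity), ← ht]
  obtain rfl | htpos := ht0.eq_or_lt
  · simp only [ne_eq, OfNat.ofNat_ne_zero, not_false_eq_true, zero_pow, mul_zero,
      intervalIntegral.integral_same, Real.sqrt_zero]
    positivity
  have hbracket : (1 + t) ^ 2 ≤ K * (1 + a * t ^ 2) := by
    have : K * (1 + a * t ^ 2) = 2 + 2 * t ^ 2 + 2 / a + 2 * a * t ^ 2 := by
      rw [hK]; field_simp; ring
    have : 0 < 2 / a := by positivity
    have : 0 ≤ 2 * a * t ^ 2 := by positivity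
    nlinarith [sq_nonneg (1 - t)]
  have hdecay (u : ℝ) (hu : a * t ^ 2 ≤ u) :
      ‖iteratedDeriv m f u‖ ≤ C * K ^ N / (1 + t) ^ (2 * N) := by
    rw [le_div_iff₀ (by positivity), pow_mul]
    calc ‖iteratedDeriv m f u‖ * ((1 + t) ^ 2) ^ N
        ≤ ‖iteratedDeriv m f u‖ * (K * (1 + |u|)) ^ N := by
          gcongr
          refine hbracket.trans ?_
          gcongr
          exact hu.trans (le_abs_self u)
      _ = (1 + |u|) ^ N * ‖iteratedDeriv m f u‖ * K ^ N := by rw [mul_pow]; ring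
      _ ≤ C * K ^ N := by gcongr; exact hC u
  calc t ^ p * √(∫ u in (a * t ^ 2)..(b * t ^ 2), ‖iteratedDeriv m f u‖ ^ 2)
      ≤ t ^ p * (√(b - a) * t * (C * K ^ N / (1 + t) ^ (2 * N))) := by
        gcongr
        exact Real.sqrt_intervalIntegral_norm_sq_le hab ht0 (by positivity) hdecay
    _ = √(b - a) * (C * K ^ N) * (t ^ (p + 1) / (1 + t) ^ (2 * N)) := by
        rw [Real.rpow_add_one htpos.ne']; ring
    _ ≤ √(b - a) * (C * K ^ N) * ((1 + t) ^ (p + 1) / (1 + t) ^ (2 * N)) := by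
        have : t ^ (p + 1) ≤ (1 + t) ^ (p + 1) :=
          Real.rpow_le_rpow ht0 (by linarith) (by linarith)
        gcongr
    _ = √(b - a) * (C * K ^ N) * (1 + t) ^ (-(2 * N - (p + 1))) := by
        rw [neg_sub, Real.rpow_sub (by positivity), ← Real.rpow_natCast (1 + t) (2 * N)]
        push_cast
        rfl

/-- Let `d ≥ 2`, `f : ℝ → ℂ` Schwartz, `0 < a < b`, and `n ∈ ℕ`, `k ∈ ℤ≥0` with
`2n ≥ k`. Then `s ↦ |s|^{2n−k−1}·(∫_{a|s|²}^{b|s|²}|f^{(n)}(u)|² du)^{1/2}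
+ |s|^{2n−k+1}·(∫_{a|s|²}^{b|s|²}|f^{(n+1)}(u)|² du)^{1/2}` is Lebesgue integrable on `ℝ^d`. -/
theorem stmt_6 (d n k : ℕ) (hd : 2 ≤ d) (hn : 1 ≤ n) (hkn : k ≤ 2 * n)
    (f : SchwartzMap ℝ ℂ) (a b : ℝ) (ha : 0 < a) (hab : a < b) :
    Integrable (fun s : EuclideanSpace ℝ (Fin d) =>
      ‖s‖ ^ (2 * (n : ℝ) - (k : ℝ) - 1) *
          Real.sqrt (∫ u in (a * ‖s‖ ^ 2)..(b * ‖s‖ ^ 2), ‖iteratedDeriv n (⇑f) u‖ ^ 2) +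
        ‖s‖ ^ (2 * (n : ℝ) - (k : ℝ) + 1) *
          Real.sqrt (∫ u in (a * ‖s‖ ^ 2)..(b * ‖s‖ ^ 2), ‖iteratedDeriv (n + 1) (⇑f) u‖ ^ 2)) := by
  have hkn' : (k : ℝ) ≤ 2 * n := by exact_mod_cast hkn
  exact (f.integrable_norm_rpow_mul_sqrt_intervalIntegral volume n ha hab.le
      (by linarith)).add
    (f.integrable_norm_rpow_mul_sqrt_intervalIntegral volume (n + 1) ha hab.le (by linarith))
end

section
/- Let d ≥ 2 be an integer and let F : (0,∞) → ℝ be a smooth function with F′(α) = α^{−d/2} for all α > 0. Then for every α > 0 with α ≠ 1: (d+2)·F^{[2]}(1,1,α) + 2α·F^{[3]}(1,1,α,α) + 4·F^{[3]}(1,1,1,α) = 0. -/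
/-- First divided difference `h^[1](a,b)` at distinct points. -/
noncomputable def dd1 (h : ℝ → ℝ) (a b : ℝ) : ℝ := (h a - h b) / (a - b)

/-- Divided difference `h^[2](a,a,b)` (using `h^[1](a,a) = h'(a)`). -/
noncomputable def dd2aab (h : ℝ → ℝ) (a b : ℝ) : ℝ := (deriv h a - dd1 h a b) / (a - b)

/-- Divided difference `h^[2](a,b,b)`. -/
noncomputable def dd2abb (h : ℝ → ℝ) (a b : ℝ) : ℝ := (dd1 h a b - deriv h b) / (a - b)

/-- Divided difference `h^[2](a,b,c)` with `a ≠ c`. -/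
noncomputable def dd2abc (h : ℝ → ℝ) (a b c : ℝ) : ℝ := (dd1 h a b - dd1 h b c) / (a - c)

/-- Divided difference `h^[3](a,a,a,b)` (using `h^[2](a,a,a) = h''(a)/2`). -/
noncomputable def dd3aaab (h : ℝ → ℝ) (a b : ℝ) : ℝ :=
  (deriv (deriv h) a / 2 - dd2aab h a b) / (a - b)

/-- Divided difference `h^[3](a,a,b,b)`. -/
noncomputable def dd3aabb (h : ℝ → ℝ) (a b : ℝ) : ℝ := (dd2aab h a b - dd2abb h a b) / (a - b)

/-- Divided difference `h^[3](a,a,c,b)`. -/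
noncomputable def dd3aacb (h : ℝ → ℝ) (a c b : ℝ) : ℝ :=
  (dd2aab h a c - dd2abc h a c b) / (a - b)

/-- Divided difference `h^[3](a,c,c,b)`. -/
noncomputable def dd3accb (h : ℝ → ℝ) (a c b : ℝ) : ℝ :=
  (dd2abb h a c - dd2aab h c b) / (a - b)

/-- Divided difference `h^[4](a,a,c,c,b)`. -/
noncomputable def dd4aaccb (h : ℝ → ℝ) (a c b : ℝ) : ℝ :=
  (dd3aabb h a c - dd3accb h a c b) / (a - b)

/-- Divided difference `h^[4](a,a,a,c,b)`. -/
noncomputable def dd4aaacb (h : ℝ → ℝ) (a c b : ℝ) : ℝ :=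
  (dd3aaab h a c - dd3aacb h a c b) / (a - b)

/-- An antiderivative `F` of `x ^ (-s)` on `(0,∞)` satisfies
`(1 - s) (F b - F a) = b ^ (1 - s) - a ^ (1 - s)`. -/
lemma one_sub_mul_sub_eq_rpow_sub_rpow {F : ℝ → ℝ} {s : ℝ}
    (hF : ∀ x : ℝ, 0 < x → HasDerivAt F (x ^ (-s)) x) {a b : ℝ} (ha : 0 < a) (hb : 0 < b) :
    (1 - s) * (F b - F a) = b ^ (1 - s) - a ^ (1 - s) := by
  have hG : ∀ x ∈ Set.Ioi (0 : ℝ),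
      HasDerivAt (fun y => (1 - s) * F y - y ^ (1 - s)) 0 x := by
    intro x hx
    have h := ((hF x hx).const_mul (1 - s)).sub
      (Real.hasDerivAt_rpow_const (p := 1 - s) (Or.inl (ne_of_gt hx)))
    rwa [show (1 - s) - 1 = -s by ring, sub_self] at h
  have hconst := isOpen_Ioi.is_const_of_deriv_eq_zero (convex_Ioi (0 : ℝ)).isPreconnected
    (fun x hx => (hG x hx).differentiableAt.differentiableWithinAt)
    (fun x hx => (hG x hx).deriv) ha hb
  linarith

/-- The second derivative of an antiderivative of `x ^ p` on `(0,∞)`. -/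
lemma deriv_deriv_of_hasDerivAt_rpow {F : ℝ → ℝ} {p : ℝ}
    (hF : ∀ x : ℝ, 0 < x → HasDerivAt F (x ^ p) x) {a : ℝ} (ha : 0 < a) :
    deriv (deriv F) a = p * a ^ (p - 1) := by
  have h : deriv F =ᶠ[nhds a] fun x => x ^ p :=
    Filter.eventually_of_mem (Ioi_mem_nhds ha) fun x hx => (hF x hx).deriv
  rw [h.deriv_eq, (Real.hasDerivAt_rpow_const (Or.inl ha.ne')).deriv]

/-- If `F` is a smooth function on `(0,∞)` with `F′(α) = α^{−d/2}` (`d ≥ 2`),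
then for every `α > 0` with `α ≠ 1`,
`(d+2)·F^[2](1,1,α) + 2α·F^[3](1,1,α,α) + 4·F^[3](1,1,1,α) = 0`. -/
theorem stmt_7 (d : ℕ) (hd : 2 ≤ d) (F : ℝ → ℝ)
    (hFsmooth : ContDiffOn ℝ (⊤ : ℕ∞) F (Set.Ioi 0))
    (hF : ∀ x : ℝ, 0 < x → HasDerivAt F (x ^ (-(d : ℝ) / 2)) x)
    (α : ℝ) (hα : 0 < α) (hα1 : α ≠ 1) :
    ((d : ℝ) + 2) * dd2aab F 1 α + 2 * α * dd3aabb F 1 α + 4 * dd3aaab F 1 α = 0 := by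
  have hderiv_one : deriv F 1 = 1 := by simpa using (hF 1 one_pos).deriv
  have hderiv := (hF α hα).deriv
  have hderiv_two : deriv (deriv F) 1 = -(d : ℝ) / 2 := by
    simpa using deriv_deriv_of_hasDerivAt_rpow hF one_pos
  have hdiff : (1 - (d : ℝ) / 2) * (F 1 - F α) = 1 - α * α ^ (-(d : ℝ) / 2) := by
    rw [one_sub_mul_sub_eq_rpow_sub_rpow (by simpa only [neg_div] using hF) hα one_pos,
      Real.one_rpow, sub_eq_add_neg 1 ((d : ℝ) / 2), Real.rpow_add hα, Real.rpow_one, neg_div]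
  have hne : 1 - α ≠ 0 := sub_ne_zero.mpr hα1.symm
  simp only [dd3aabb, dd3aaab, dd2aab, dd2abb, dd1, hderiv_one, hderiv, hderiv_two]
  generalize α ^ (-(d : ℝ) / 2) = p at hdiff ⊢
  field_simp
  linear_combination 8 * (1 - α) * hdiff
end

section
/- Let d ≥ 2 be an integer and let F : (0,∞) → ℝ be a smooth function with F′(α) = α^{−d/2} for all α > 0. Define, for α > 0 with α ≠ 1, f(α) := F^{[2]}(1,1,α) + (d/2 − 1)·F^{[1]}(1,α) and g(α) := F(α) + F^{[1]}(1,α). Then for every α > 0 with α ≠ 1: f(α) + g′(α) = 0, where g′ is the derivative of g as a function on (0,∞)\{1}. -/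
/-- If `F' = x ^ (-s)` on `(0, ∞)`, then `(s - 1) * F x + x * x ^ (-s)` is constant there. -/
theorem sub_one_mul_add_mul_rpow_neg_eq {F : ℝ → ℝ} {s : ℝ}
    (hF : ∀ x : ℝ, 0 < x → HasDerivAt F (x ^ (-s)) x) {x y : ℝ} (hx : 0 < x) (hy : 0 < y) :
    (s - 1) * F x + x * x ^ (-s) = (s - 1) * F y + y * y ^ (-s) := by
  have hderiv : ∀ z ∈ Set.Ioi (0 : ℝ),
      HasDerivAt (fun z => (s - 1) * F z + z * z ^ (-s)) 0 z := by
    intro z hz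
    have hz : 0 < z := hz
    refine (((hF z hz).const_mul (s - 1)).add
      ((hasDerivAt_id z).mul (Real.hasDerivAt_rpow_const (p := -s) (Or.inl hz.ne')))).congr_deriv ?_
    rw [Real.rpow_sub_one hz.ne']
    simp only [id]
    field_simp
    ring
  exact (convex_Ioi (0 : ℝ)).is_const_of_fderivWithin_eq_zero (𝕜 := ℝ)
    (fun z hz => (hderiv z hz).differentiableAt.differentiableWithinAt)
    (fun z hz => by
      rw [fderivWithin_of_isOpen isOpen_Ioi hz]
      ext
      simpa using (hderiv z hz).deriv) hx hy

/-- Let `F` be smooth on `(0,∞)` with `F′(α) = α^{−d/2}` (`d ≥ 2`). Define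
`f(α) := F^[2](1,1,α) + (d/2 − 1)·F^[1](1,α)` and `g(α) := F(α) + F^[1](1,α)`, both for
`α > 0`, `α ≠ 1`. Then `f(α) + g′(α) = 0` for every such `α`. -/
theorem stmt_11 (d : ℕ) (hd : 2 ≤ d) (F : ℝ → ℝ)
    (hFsmooth : ContDiffOn ℝ (⊤ : ℕ∞) F (Set.Ioi 0))
    (hF : ∀ x : ℝ, 0 < x → HasDerivAt F (x ^ (-(d : ℝ) / 2)) x)
    (α : ℝ) (hα : 0 < α) (hα1 : α ≠ 1) :
    (dd2aab F 1 α + ((d : ℝ) / 2 - 1) * dd1 F 1 α) +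
      deriv (fun x => F x + (F 1 - F x) / (1 - x)) α = 0 := by
  have hu : 1 - α ≠ 0 := sub_ne_zero.mpr hα1.symm
  have hg := (hF α hα).add
    (((hF α hα).const_sub (F 1)).div ((hasDerivAt_id α).const_sub 1) hu)
  have hg' : deriv (fun x => F x + (F 1 - F x) / (1 - x)) α = _ := hg.deriv
  have key := sub_one_mul_add_mul_rpow_neg_eq (s := (d : ℝ) / 2)
    (fun x hx => by simpa only [neg_div] using hF x hx) hα one_pos
  rw [← neg_div, Real.one_rpow] at key
  rw [hg', dd2aab, dd1, (hF 1 one_pos).deriv, Real.one_rpow]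
  simp only [id]
  generalize α ^ (-(d : ℝ) / 2) = p at key ⊢
  field_simp
  linear_combination (-2 * (1 - α)) * key
end

section
/- For every α > 0 with α ≠ 1, writing s := log α, one has α^{1/2} · ( log^{[2]}(1,1,α) + 2·log^{[3]}(1,1,1,α) ) = (1/2) · K_0(s) · (log α)/(α − 1), where K_0(s) := (−2 + s·coth(s/2))/(s·sinh(s/2)). -/
/-- The Connes–Moscovici function `K₀(s) = (−2 + s·coth(s/2))/(s·sinh(s/2))`. -/
noncomputable def K0 (s : ℝ) : ℝ :=
  (-2 + s * (Real.cosh (s / 2) / Real.sinh (s / 2))) / (s * Real.sinh (s / 2))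

/-- For every `α > 0` with `α ≠ 1`, writing `s := log α`,
`α^{1/2}·(log^[2](1,1,α) + 2·log^[3](1,1,1,α)) = (1/2)·K₀(s)·(log α)/(α − 1)`. -/
theorem stmt_12 (α : ℝ) (hα : 0 < α) (hα1 : α ≠ 1) :
    Real.sqrt α * (dd2aab Real.log 1 α + 2 * dd3aaab Real.log 1 α)
      = 1 / 2 * K0 (Real.log α) * (Real.log α / (α - 1)) := by
  have hx : α - 1 ≠ 0 := sub_ne_zero.mpr hα1
  have hL : Real.log α ≠ 0 := Real.log_ne_zero_of_pos_of_ne_one hα hα1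
  obtain ⟨r, hr, hr0, rfl⟩ : ∃ r, Real.sqrt α = r ∧ 0 < r ∧ α = r ^ 2 :=
    ⟨_, rfl, Real.sqrt_pos.mpr hα, (Real.sq_sqrt hα.le).symm⟩
  have hexp : Real.exp (Real.log (r ^ 2) / 2) = r := by
    rw [← Real.log_sqrt hα.le, hr, Real.exp_log hr0]
  have hsinh : Real.sinh (Real.log (r ^ 2) / 2) = (r ^ 2 - 1) / (2 * r) := by
    rw [Real.sinh_eq, Real.exp_neg, hexp]
    field_simp
  have hcosh : Real.cosh (Real.log (r ^ 2) / 2) = (r ^ 2 + 1) / (2 * r) := by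
    rw [Real.cosh_eq, Real.exp_neg, hexp]
    field_simp
  have hderiv : deriv (deriv Real.log) 1 = -1 := by
    simp [Real.deriv_log']
  simp only [dd3aaab, dd2aab, dd1, K0]
  rw [hderiv, hsinh, hcosh, hr, Real.deriv_log, Real.log_one, ← neg_sub (r ^ 2) 1]
  field_simp
  ring
end

section
/- Define g(α) := log α + (log α)/(α − 1) for α > 0, α ≠ 1 (so g(α) = log α + log^{[1]}(1,α)), K_0(s) := (−2 + s·coth(s/2))/(s·sinh(s/2)) for s ≠ 0, and H_0(s,t) := ( t(s+t)cosh(s) − s(s+t)cosh(t) + (s−t)(s + t + sinh(s) + sinh(t) − sinh(s+t)) ) / ( s·t·(s+t)·sinh(s/2)·sinh(t/2)·sinh²((s+t)/2) ) for s, t, s+t all nonzero. Then for all α, β > 0 with α ≠ 1, β ≠ 1 and α ≠ β: −2(α·β)^{1/2}·g^{[3]}(α,α,β,β) = K_0(log(β/α))·log^{[2]}(α,1,β) + (1/4)·H_0(−log α, log β)·log^{[1]}(α,1)·log^{[1]}(1,β). -/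
/-- The Connes–Moscovici function `H₀(s,t)`. -/
noncomputable def H0 (s t : ℝ) : ℝ :=
  (t * (s + t) * Real.cosh s - s * (s + t) * Real.cosh t +
      (s - t) * (s + t + Real.sinh s + Real.sinh t - Real.sinh (s + t))) /
    (s * t * (s + t) * Real.sinh (s / 2) * Real.sinh (t / 2) * Real.sinh ((s + t) / 2) ^ 2)

/-- The derivative of `g(x) = log x + (log x)/(x − 1)` away from `0` and `1`. -/
lemma deriv_log_add_log_div_sub_one {x : ℝ} (hx : x ≠ 0) (hx1 : x ≠ 1) :
    deriv (fun x => Real.log x + Real.log x / (x - 1)) x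
      = x⁻¹ + (x⁻¹ * (x - 1) - Real.log x) / (x - 1) ^ 2 := by
  have hlog := Real.hasDerivAt_log hx
  have hsub : HasDerivAt (fun x : ℝ => x - 1) 1 x := (hasDerivAt_id x).sub_const 1
  have h := hlog.add (hlog.div hsub (sub_ne_zero.2 hx1))
  rw [mul_one] at h
  exact h.deriv

/-- `K₀` at twice a logarithm is a rational expression. -/
lemma K0_two_mul_log {c : ℝ} (hc : 0 < c) (hc1 : c ≠ 1) :
    K0 (2 * Real.log c) = 2 * c * (-(c ^ 2 - 1) + Real.log c * (c ^ 2 + 1)) /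
      (Real.log c * (c ^ 2 - 1) ^ 2) := by
  have hl : Real.log c ≠ 0 := Real.log_ne_zero_of_pos_of_ne_one hc hc1
  have hc2 : c ^ 2 - 1 ≠ 0 := by
    rw [sub_ne_zero, Ne, pow_eq_one_iff_of_nonneg hc.le two_ne_zero]
    exact hc1
  have hs : Real.sinh (Real.log c) = (c ^ 2 - 1) / (2 * c) := by
    rw [Real.sinh_log hc]; field_simp
  have hch : Real.cosh (Real.log c) = (c ^ 2 + 1) / (2 * c) := by
    rw [Real.cosh_log hc]; field_simp
  rw [K0, mul_div_cancel_left₀ _ (two_ne_zero' ℝ), hs, hch]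
  field_simp

/-- `H₀` at twice logarithms is a rational expression. -/
lemma H0_neg_two_mul_log {a b : ℝ} (ha : 0 < a) (hb : 0 < b) :
    H0 (-(2 * Real.log a)) (2 * Real.log b) =
      (4 * Real.log b * (Real.log b - Real.log a) * ((a ^ 2 + (a ^ 2)⁻¹) / 2) +
        4 * Real.log a * (Real.log b - Real.log a) * ((b ^ 2 + (b ^ 2)⁻¹) / 2) -
        2 * (Real.log a + Real.log b) * (2 * (Real.log b - Real.log a) -
          (a ^ 2 - (a ^ 2)⁻¹) / 2 + (b ^ 2 - (b ^ 2)⁻¹) / 2 -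
          (b ^ 2 / a ^ 2 - a ^ 2 / b ^ 2) / 2)) /
      (8 * Real.log a * Real.log b * (Real.log b - Real.log a) * ((a - a⁻¹) / 2) *
        ((b - b⁻¹) / 2) * ((b / a - a / b) / 2) ^ 2) := by
  have hla : 2 * Real.log a = Real.log (a ^ 2) := by rw [Real.log_pow]; norm_num
  have hlb : 2 * Real.log b = Real.log (b ^ 2) := by rw [Real.log_pow]; norm_num
  have hsum : -(2 * Real.log a) + 2 * Real.log b = Real.log (b ^ 2 / a ^ 2) := by
    rw [Real.log_div (by positivity) (by positivity), ← hla, ← hlb]; ring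
  have hhalf : (-(2 * Real.log a) + 2 * Real.log b) / 2 = Real.log (b / a) := by
    rw [Real.log_div hb.ne' ha.ne']; ring
  have hca : Real.cosh (-(2 * Real.log a)) = (a ^ 2 + (a ^ 2)⁻¹) / 2 := by
    rw [Real.cosh_neg, hla, Real.cosh_log (by positivity)]
  have hcb : Real.cosh (2 * Real.log b) = (b ^ 2 + (b ^ 2)⁻¹) / 2 := by
    rw [hlb, Real.cosh_log (by positivity)]
  have hsa : Real.sinh (-(2 * Real.log a)) = -((a ^ 2 - (a ^ 2)⁻¹) / 2) := by
    rw [Real.sinh_neg, hla, Real.sinh_log (by positivity)]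
  have hsb : Real.sinh (2 * Real.log b) = (b ^ 2 - (b ^ 2)⁻¹) / 2 := by
    rw [hlb, Real.sinh_log (by positivity)]
  have hsab : Real.sinh (-(2 * Real.log a) + 2 * Real.log b) =
      (b ^ 2 / a ^ 2 - a ^ 2 / b ^ 2) / 2 := by
    rw [hsum, Real.sinh_log (by positivity), inv_div]
  have hsa2 : Real.sinh (-(2 * Real.log a) / 2) = -((a - a⁻¹) / 2) := by
    rw [neg_div, mul_div_cancel_left₀ _ (two_ne_zero' ℝ), Real.sinh_neg, Real.sinh_log ha]
  have hsb2 : Real.sinh (2 * Real.log b / 2) = (b - b⁻¹) / 2 := by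
    rw [mul_div_cancel_left₀ _ (two_ne_zero' ℝ), Real.sinh_log hb]
  have hsab2 : Real.sinh ((-(2 * Real.log a) + 2 * Real.log b) / 2) = (b / a - a / b) / 2 := by
    rw [hhalf, Real.sinh_log (by positivity), inv_div]
  rw [H0, hca, hcb, hsa, hsb, hsab, hsa2, hsb2, hsab2]
  congr 1 <;> ring

/-- With `g(α) := log α + (log α)/(α − 1)`, for all `α, β > 0` with `α ≠ 1`,
`β ≠ 1`, `α ≠ β`:
`−2(αβ)^{1/2}·g^[3](α,α,β,β) = K₀(log(β/α))·log^[2](α,1,β)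
   + (1/4)·H₀(−log α, log β)·log^[1](α,1)·log^[1](1,β)`. -/
theorem stmt_13 (α β : ℝ) (hα : 0 < α) (hβ : 0 < β) (hα1 : α ≠ 1) (hβ1 : β ≠ 1)
    (hne : α ≠ β) :
    -2 * Real.sqrt (α * β) * dd3aabb (fun x => Real.log x + Real.log x / (x - 1)) α β
      = K0 (Real.log (β / α)) * dd2abc Real.log α 1 β +
        1 / 4 * H0 (-Real.log α) (Real.log β) * dd1 Real.log α 1 * dd1 Real.log 1 β := by
  obtain ⟨a, ha, rfl⟩ : ∃ a : ℝ, 0 < a ∧ a ^ 2 = α := ⟨√α, Real.sqrt_pos.2 hα, Real.sq_sqrt hα.le⟩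
  obtain ⟨b, hb, rfl⟩ : ∃ b : ℝ, 0 < b ∧ b ^ 2 = β := ⟨√β, Real.sqrt_pos.2 hβ, Real.sq_sqrt hβ.le⟩
  have ha1 : a ≠ 1 := by rintro rfl; simp at hα1
  have hb1 : b ≠ 1 := by rintro rfl; simp at hβ1
  have hab : a ≠ b := by rintro rfl; exact hne rfl
  have hla : Real.log (a ^ 2) = 2 * Real.log a := by rw [Real.log_pow]; norm_num
  have hlb : Real.log (b ^ 2) = 2 * Real.log b := by rw [Real.log_pow]; norm_num
  have hlba : Real.log (b ^ 2 / a ^ 2) = 2 * Real.log (b / a) := by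
    rw [← div_pow, Real.log_pow]; norm_num
  have hsqrt : √(a ^ 2 * b ^ 2) = a * b := by
    rw [← mul_pow, Real.sqrt_sq (by positivity)]
  have hba1 : b / a ≠ 1 := by
    rw [Ne, div_eq_one_iff_eq ha.ne']; exact hab.symm
  rw [dd3aabb, dd2aab, dd2abb, deriv_log_add_log_div_sub_one hα.ne' hα1,
    deriv_log_add_log_div_sub_one hβ.ne' hβ1, hlba, K0_two_mul_log (by positivity) hba1,
    hla, hlb, H0_neg_two_mul_log ha hb, hsqrt, Real.log_div hb.ne' ha.ne']
  simp only [dd1, dd2abc, hla, hlb, Real.log_one]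
  have hx : Real.log a ≠ 0 := Real.log_ne_zero_of_pos_of_ne_one ha ha1
  have hy : Real.log b ≠ 0 := Real.log_ne_zero_of_pos_of_ne_one hb hb1
  have hxy : Real.log b - Real.log a ≠ 0 :=
    sub_ne_zero.2 fun h => hab (Real.log_injOn_pos hb ha h).symm
  generalize Real.log a = x at *
  generalize Real.log b = y at *
  have hA : a ^ 2 - 1 ≠ 0 := sub_ne_zero.2 hα1
  have hB : b ^ 2 - 1 ≠ 0 := sub_ne_zero.2 hβ1
  have hAB : a ^ 2 - b ^ 2 ≠ 0 := sub_ne_zero.2 hne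
  have hc : (b / a) ^ 2 - 1 = -(a ^ 2 - b ^ 2) / a ^ 2 := by field_simp; ring
  have hc' : b / a - a / b = -(a ^ 2 - b ^ 2) / (a * b) := by field_simp; ring
  have hia : a - a⁻¹ = (a ^ 2 - 1) / a := by field_simp
  have hib : b - b⁻¹ = (b ^ 2 - 1) / b := by field_simp
  have hB' : 1 - b ^ 2 = -(b ^ 2 - 1) := by ring
  rw [hc, hc', hia, hib, hB']
  field_simp
  ring
end

section
/- Let d ≥ 3 be an integer and let F : (0,∞) → ℝ be a smooth function with F′(α) = α^{−d/2} for all α > 0. Then for every α > 0 with α ≠ 1: (4·α^{1/2}/d) · ( F^{[2]}(1,1,α) − α·F^{[2]}(1,α,α) ) / log α = K_0^d(log α), where K_0^d(s) := (2/d)·( −1 − e^{(1−d/2)s} + ((e^{(1−d/2)s} − 1)/(1 − d/2))·coth(s/2) )/( s·sinh(s/2) ). -/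
/-- The function `K₀^d(s)` of the paper, for real `d ≠ 2` and `s ≠ 0`. -/
noncomputable def K0d (d s : ℝ) : ℝ :=
  2 / d * ((-1 - Real.exp ((1 - d / 2) * s) +
      (Real.exp ((1 - d / 2) * s) - 1) / (1 - d / 2) *
        (Real.cosh (s / 2) / Real.sinh (s / 2))) / (s * Real.sinh (s / 2)))

/-- The increment from `1` of an antiderivative of `x ^ (c - 1)` on `(0, ∞)`. -/
theorem sub_eq_of_hasDerivAt_rpow {F : ℝ → ℝ} {c : ℝ} (hc : c ≠ 0)
    (hF : ∀ x : ℝ, 0 < x → HasDerivAt F (x ^ (c - 1)) x) {α : ℝ} (hα : 0 < α) :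
    F α - F 1 = (α ^ c - 1) / c := by
  have hderiv : ∀ x ∈ Set.Ioi (0 : ℝ), HasDerivAt (fun y => F y - y ^ c / c) 0 x := by
    intro x hx
    have h := (hF x hx).sub
      ((Real.hasDerivAt_rpow_const (p := c) (Or.inl (ne_of_gt hx))).div_const c)
    rwa [mul_div_cancel_left₀ _ hc, sub_self] at h
  have hconst := isOpen_Ioi.is_const_of_deriv_eq_zero isPreconnected_Ioi
    (fun x hx => (hderiv x hx).differentiableAt.differentiableWithinAt)
    (fun x hx => (hderiv x hx).deriv) (Set.mem_Ioi.2 hα) (Set.mem_Ioi.2 one_pos)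
  simp only [Real.one_rpow] at hconst
  rw [sub_div]
  linarith

theorem sinh_log_div_two {α : ℝ} (hα : 0 < α) :
    Real.sinh (Real.log α / 2) = (α - 1) / (2 * √α) := by
  have hsqrt : 0 < √α := Real.sqrt_pos.2 hα
  rw [← Real.log_sqrt hα.le, Real.sinh_log hsqrt]
  field_simp
  rw [Real.sq_sqrt hα.le]

theorem cosh_log_div_two {α : ℝ} (hα : 0 < α) :
    Real.cosh (Real.log α / 2) = (α + 1) / (2 * √α) := by
  have hsqrt : 0 < √α := Real.sqrt_pos.2 hα
  rw [← Real.log_sqrt hα.le, Real.cosh_log hsqrt]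
  field_simp
  rw [Real.sq_sqrt hα.le]

/-- Let `d ≥ 3` and let `F` be smooth on `(0,∞)` with `F′(α) = α^{−d/2}`.
Then for every `α > 0` with `α ≠ 1`:
`(4·α^{1/2}/d)·(F^[2](1,1,α) − α·F^[2](1,α,α))/log α = K₀^d(log α)`. -/
theorem stmt_16 (d : ℕ) (hd : 3 ≤ d) (F : ℝ → ℝ)
    (hFsmooth : ContDiffOn ℝ (⊤ : ℕ∞) F (Set.Ioi 0))
    (hF : ∀ x : ℝ, 0 < x → HasDerivAt F (x ^ (-(d : ℝ) / 2)) x)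
    (α : ℝ) (hα : 0 < α) (hα1 : α ≠ 1) :
    4 * Real.sqrt α / (d : ℝ) * (dd2aab F 1 α - α * dd2abb F 1 α) / Real.log α
      = K0d (d : ℝ) (Real.log α) := by
  have hd' : (3 : ℝ) ≤ d := by exact_mod_cast hd
  obtain ⟨c, hcdef⟩ : ∃ c : ℝ, c = 1 - (d : ℝ) / 2 := ⟨_, rfl⟩
  have hc : c ≠ 0 := by linarith
  have hexp : -(d : ℝ) / 2 = c - 1 := by rw [hcdef]; ring
  rw [hexp] at hF
  have hinc : F 1 - F α = -((α ^ c - 1) / c) := by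
    rw [← sub_eq_of_hasDerivAt_rpow hc hF hα, neg_sub]
  have hsub : α - 1 ≠ 0 := sub_ne_zero.2 hα1
  have hsub' : 1 - α ≠ 0 := sub_ne_zero.2 hα1.symm
  have hlog : Real.log α ≠ 0 := Real.log_ne_zero_of_pos_of_ne_one hα hα1
  have hsqrt : √α ≠ 0 := (Real.sqrt_pos.2 hα).ne'
  have hpow : Real.exp (c * Real.log α) = α ^ c := by
    rw [Real.rpow_def_of_pos hα, mul_comm]
  have hdiff : dd2aab F 1 α - α * dd2abb F 1 α =
      (-1 - α ^ c + (α ^ c - 1) / c * ((α + 1) / (α - 1))) / (α - 1) := by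
    rw [dd2aab, dd2abb, dd1, (hF 1 one_pos).deriv, (hF α hα).deriv, hinc, Real.one_rpow,
      Real.rpow_sub_one hα.ne', ← neg_sub α 1]
    field_simp
    ring
  rw [hdiff, K0d, ← hcdef, hpow, sinh_log_div_two hα, cosh_log_div_two hα,
    div_div_div_cancel_right₀ (mul_ne_zero two_ne_zero hsqrt)]
  have hd0 : (d : ℝ) ≠ 0 := by linarith
  field_simp
  ring
end

section
/- Let d ≥ 2 be an integer and let n_1, …, n_d be nonnegative integers. If all n_j are even, then (1/σ(S^{d−1})) · ∫_{S^{d−1}} Π_{j=1}^{d} u_j^{n_j} dσ(u) = ( (d−2)!! · Π_{j=1}^{d} (n_j − 1)!! ) / ( (n_1 + … + n_d) + d − 2 )!!. If some n_j is odd, then ∫_{S^{d−1}} Π_{j=1}^{d} u_j^{n_j} dσ(u) = 0. -/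
open MeasureTheory Metric Set

/-- The surface measure of the unit sphere of `ℝ^d`, seen as a measure on the ambient space. -/
noncomputable def sphereMeasure (d : ℕ) : Measure (EuclideanSpace ℝ (Fin d)) :=
  μH[(d : ℝ) - 1].restrict (sphere (0 : EuclideanSpace ℝ (Fin d)) 1)

theorem lipschitzOnWith_inv_norm_smul {E : Type*} [NormedAddCommGroup E] [NormedSpace ℝ E] :
    LipschitzOnWith 2 (fun x : E => ‖x‖⁻¹ • x) {x | 1 ≤ ‖x‖} := by
  refine LipschitzOnWith.of_dist_le_mul fun x hx y hy => ?_
  simp only [mem_ofPred_eq] at hx hy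
  have hx0 : 0 < ‖x‖ := by linarith
  have hy0 : 0 < ‖y‖ := by linarith
  have hdecomp : ‖x‖⁻¹ • x - ‖y‖⁻¹ • y = ‖x‖⁻¹ • (x - y) + (‖x‖⁻¹ - ‖y‖⁻¹) • y := by
    module
  have hcoef : |‖x‖⁻¹ - ‖y‖⁻¹| * ‖y‖ = ‖x‖⁻¹ * |‖x‖ - ‖y‖| := by
    have : ‖x‖⁻¹ - ‖y‖⁻¹ = ‖x‖⁻¹ * ‖y‖⁻¹ * (‖y‖ - ‖x‖) := by field_simp
    rw [this, abs_mul, abs_of_pos (by positivity), abs_sub_comm]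
    field_simp
  have hinv : ‖x‖⁻¹ ≤ 1 := inv_le_one_of_one_le₀ hx
  rw [dist_eq_norm, dist_eq_norm, hdecomp]
  calc ‖‖x‖⁻¹ • (x - y) + (‖x‖⁻¹ - ‖y‖⁻¹) • y‖
      ≤ ‖x‖⁻¹ * ‖x - y‖ + ‖x‖⁻¹ * |‖x‖ - ‖y‖| := by
        refine (norm_add_le _ _).trans (le_of_eq ?_)
        rw [norm_smul, norm_smul, Real.norm_eq_abs, Real.norm_eq_abs, hcoef,
          abs_of_pos (inv_pos.2 hx0)]
    _ ≤ 1 * ‖x - y‖ + 1 * ‖x - y‖ := by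
        gcongr
        exact abs_norm_sub_norm_le x y
    _ = ((2 : NNReal) : ℝ) * ‖x - y‖ := by
        push_cast
        ring

theorem lipschitzWith_toLp_insertNth (m : ℕ) (j : Fin (m + 1)) (s : ℝ) :
    ∃ K, LipschitzWith K fun x : Fin m → ℝ =>
      (WithLp.toLp 2 (j.insertNth s x : Fin (m + 1) → ℝ) : EuclideanSpace ℝ (Fin (m + 1))) := by
  have hins : LipschitzWith 1 fun x : Fin m → ℝ => (j.insertNth s x : Fin (m + 1) → ℝ) := by
    refine LipschitzWith.of_dist_le_mul fun x y => ?_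
    rw [Fin.dist_insertNth_insertNth]
    simp
  exact ⟨_, (PiLp.lipschitzWith_toLp 2 fun _ : Fin (m + 1) => ℝ).comp hins⟩

theorem one_le_norm_toLp_insertNth {m : ℕ} (j : Fin (m + 1)) {s : ℝ} (hs : |s| = 1)
    (x : Fin m → ℝ) :
    1 ≤ ‖(WithLp.toLp 2 (j.insertNth s x : Fin (m + 1) → ℝ) :
      EuclideanSpace ℝ (Fin (m + 1)))‖ := by
  have := PiLp.norm_apply_le
    (WithLp.toLp 2 (j.insertNth s x : Fin (m + 1) → ℝ) : EuclideanSpace ℝ (Fin (m + 1))) j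
  simpa [hs] using this

/-- The unit sphere is covered by the radial projections of the faces of the cube `[-1, 1]^d`. -/
theorem sphere_subset_iUnion_faces (m : ℕ) :
    sphere (0 : EuclideanSpace ℝ (Fin (m + 1))) 1 ⊆
      ⋃ p : Fin (m + 1) × ℤˣ, (fun x : EuclideanSpace ℝ (Fin (m + 1)) => ‖x‖⁻¹ • x) ''
        ((fun x : Fin m → ℝ => (WithLp.toLp 2 (p.1.insertNth ((p.2 : ℤ) : ℝ) x :
          Fin (m + 1) → ℝ) : EuclideanSpace ℝ (Fin (m + 1)))) '' closedBall 0 1) := by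
  intro u hu
  have hu1 : ‖u‖ = 1 := by simpa using hu
  obtain ⟨j, hj⟩ := Finite.exists_max fun k => |u k|
  have hpos : 0 < |u j| := by
    by_contra! h
    have : u = 0 := by
      ext k
      exact abs_nonpos_iff.1 ((hj k).trans h)
    simp [this] at hu1
  obtain ⟨ε, hε⟩ : ∃ ε : ℤˣ, ((ε : ℤ) : ℝ) = |u j|⁻¹ * u j := by
    rcases abs_choice (u j) with h | h
    · exact ⟨1, by rw [h] at hpos ⊢; simp [hpos.ne']⟩
    · refine ⟨-1, ?_⟩
      have : u j ≠ 0 := abs_pos.1 hpos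
      rw [h]
      field_simp
      simp
  have hface : (WithLp.toLp 2 (j.insertNth ((ε : ℤ) : ℝ) (fun k => |u j|⁻¹ * u (j.succAbove k)) :
      Fin (m + 1) → ℝ) : EuclideanSpace ℝ (Fin (m + 1))) = |u j|⁻¹ • u := by
    ext k
    refine Fin.succAboveCases j ?_ (fun k => ?_) k
    · simp [hε]
    · simp
  refine mem_iUnion.2 ⟨(j, ε), _, ⟨fun k => |u j|⁻¹ * u (j.succAbove k), ?_, rfl⟩, ?_⟩
  · rw [mem_closedBall_zero_iff, pi_norm_le_iff_of_nonneg zero_le_one]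
    intro k
    rw [norm_mul, norm_inv, Real.norm_eq_abs, Real.norm_eq_abs, abs_abs, inv_mul_le_one₀ hpos]
    exact hj _
  · simp only [hface, norm_smul, hu1, norm_inv, Real.norm_eq_abs, abs_abs, mul_one, inv_inv,
      smul_smul]
    rw [mul_inv_cancel₀ hpos.ne', one_smul]

theorem hausdorffMeasure_fin_eq_volume (m : ℕ) :
    (μH[(m : ℝ)] : Measure (Fin m → ℝ)) = volume := by
  simpa using hausdorffMeasure_pi_real (ι := Fin m)

theorem hausdorffMeasure_sphere_lt_top (m : ℕ) :
    μH[(m : ℝ)] (sphere (0 : EuclideanSpace ℝ (Fin (m + 1))) 1) < ⊤ := by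
  refine (measure_mono (sphere_subset_iUnion_faces m)).trans_lt ?_
  refine (measure_iUnion_fintype_le _ _).trans_lt (ENNReal.sum_lt_top.2 fun p _ => ?_)
  have hs : |((p.2 : ℤ) : ℝ)| = 1 := by
    rcases Int.units_eq_one_or p.2 with h | h <;> simp [h]
  obtain ⟨K, hK⟩ := lipschitzWith_toLp_insertNth m p.1 ((p.2 : ℤ) : ℝ)
  have hm : (0 : ℝ) ≤ m := m.cast_nonneg
  refine ((lipschitzOnWith_inv_norm_smul.mono ?_).hausdorffMeasure_image_le hm).trans_lt ?_
  · rintro _ ⟨x, -, rfl⟩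
    exact one_le_norm_toLp_insertNth p.1 hs x
  refine ENNReal.mul_lt_top (ENNReal.rpow_lt_top_of_nonneg hm (by simp)) ?_
  refine (hK.hausdorffMeasure_image_le hm _).trans_lt ?_
  refine ENNReal.mul_lt_top (ENNReal.rpow_lt_top_of_nonneg hm (by simp)) ?_
  rw [hausdorffMeasure_fin_eq_volume]
  exact measure_closedBall_lt_top

theorem hausdorffMeasure_sphere_pos (m : ℕ) :
    0 < μH[(m : ℝ)] (sphere (0 : EuclideanSpace ℝ (Fin (m + 1))) 1) := by
  have hproj : LipschitzWith 1 fun (u : EuclideanSpace ℝ (Fin (m + 1))) (k : Fin m) =>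
      u k.succ := by
    refine LipschitzWith.of_dist_le_mul fun u v => ?_
    rw [dist_pi_le_iff (by positivity)]
    intro k
    have := PiLp.norm_apply_le (u - v) k.succ
    simpa [dist_eq_norm] using this
  have hsub : {x : Fin m → ℝ | ∑ k, x k ^ 2 < 1} ⊆
      (fun (u : EuclideanSpace ℝ (Fin (m + 1))) (k : Fin m) => u k.succ) '' sphere 0 1 := by
    intro x hx
    refine ⟨WithLp.toLp 2 (Fin.cons (√(1 - ∑ k, x k ^ 2)) x), ?_, by ext; simp⟩
    have hx' : 0 ≤ 1 - ∑ k, x k ^ 2 := by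
      have : ∑ k, x k ^ 2 < 1 := hx
      linarith
    rw [mem_sphere_zero_iff_norm, EuclideanSpace.norm_eq, Real.sqrt_eq_one, Fin.sum_univ_succ]
    simp [Real.sq_sqrt hx']
  have hopen : IsOpen {x : Fin m → ℝ | ∑ k, x k ^ 2 < 1} :=
    isOpen_lt (by fun_prop) continuous_const
  have hvol : 0 < volume {x : Fin m → ℝ | ∑ k, x k ^ 2 < 1} :=
    hopen.measure_pos _ ⟨0, by simp⟩
  rw [← hausdorffMeasure_fin_eq_volume] at hvol
  have hle := hproj.hausdorffMeasure_image_le (m.cast_nonneg : (0 : ℝ) ≤ m)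
    (sphere (0 : EuclideanSpace ℝ (Fin (m + 1))) 1)
  rw [ENNReal.coe_one, ENNReal.one_rpow, one_mul] at hle
  exact hvol.trans_le ((measure_mono hsub).trans hle)

theorem isFiniteMeasure_sphereMeasure {d : ℕ} (hd : d ≠ 0) :
    IsFiniteMeasure (sphereMeasure d) := by
  obtain ⟨m, rfl⟩ := Nat.exists_eq_succ_of_ne_zero hd
  refine ⟨?_⟩
  rw [sphereMeasure, Measure.restrict_apply_univ]
  simpa using hausdorffMeasure_sphere_lt_top m

theorem sphereMeasure_real_univ_pos {d : ℕ} (hd : d ≠ 0) :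
    0 < (sphereMeasure d).real univ := by
  have := isFiniteMeasure_sphereMeasure hd
  obtain ⟨m, rfl⟩ := Nat.exists_eq_succ_of_ne_zero hd
  refine ENNReal.toReal_pos ?_ (measure_ne_top _ _)
  rw [sphereMeasure, Measure.restrict_apply_univ]
  simpa using (hausdorffMeasure_sphere_pos m).ne'

theorem ae_mem_sphere (d : ℕ) : ∀ᵐ u ∂sphereMeasure d, ‖u‖ = 1 := by
  filter_upwards [ae_restrict_mem (isClosed_sphere.measurableSet)] with u hu
  simpa using hu

theorem integral_sphereMeasure_comp {d : ℕ}
    (e : EuclideanSpace ℝ (Fin d) ≃ₗᵢ[ℝ] EuclideanSpace ℝ (Fin d))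
    (f : EuclideanSpace ℝ (Fin d) → ℝ) :
    ∫ u, f (e u) ∂sphereMeasure d = ∫ u, f u ∂sphereMeasure d := by
  have h := (e.toIsometryEquiv.measurePreserving_hausdorffMeasure
    ((d : ℝ) - 1)).setIntegral_preimage_emb
      e.toHomeomorph.measurableEmbedding f (sphere 0 1)
  have hpre : e.toIsometryEquiv ⁻¹' sphere 0 1 = sphere (0 : EuclideanSpace ℝ (Fin d)) 1 := by
    ext u
    simp
  rw [hpre] at h
  exact h

theorem integrable_sphereMeasure {d : ℕ} (hd : d ≠ 0) {f : EuclideanSpace ℝ (Fin d) → ℝ}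
    (hf : Continuous f) : Integrable f (sphereMeasure d) := by
  have := isFiniteMeasure_sphereMeasure hd
  obtain ⟨C, hC⟩ := (isCompact_sphere (0 : EuclideanSpace ℝ (Fin d)) 1).exists_bound_of_continuousOn
    hf.continuousOn
  refine Integrable.of_bound hf.aestronglyMeasurable C ?_
  filter_upwards [ae_mem_sphere d] with u hu
  exact hC u (by simpa using hu)

theorem hasDerivAt_integral_sphereMeasure {d : ℕ} (hd : d ≠ 0)
    {F F' : ℝ → EuclideanSpace ℝ (Fin d) → ℝ} (hF : ∀ t, Continuous (F t))
    (hF' : Continuous fun p : ℝ × EuclideanSpace ℝ (Fin d) => F' p.1 p.2)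
    (hderiv : ∀ t u, HasDerivAt (fun s => F s u) (F' t u) t) (t₀ : ℝ) :
    HasDerivAt (fun t => ∫ u, F t u ∂sphereMeasure d) (∫ u, F' t₀ u ∂sphereMeasure d) t₀ := by
  have := isFiniteMeasure_sphereMeasure hd
  obtain ⟨C, hC⟩ := ((isCompact_Icc (a := t₀ - 1) (b := t₀ + 1)).prod
    (isCompact_sphere (0 : EuclideanSpace ℝ (Fin d)) 1)).exists_bound_of_continuousOn
      hF'.continuousOn
  have hF't₀ : Continuous (F' t₀) := hF'.comp (Continuous.prodMk_right t₀)
  refine (hasDerivAt_integral_of_dominated_loc_of_deriv_le (bound := fun _ => C)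
    (Icc_mem_nhds (sub_one_lt t₀) (lt_add_one t₀))
    (Filter.Eventually.of_forall fun t => (hF t).aestronglyMeasurable)
    (integrable_sphereMeasure hd (hF t₀)) hF't₀.aestronglyMeasurable ?_ (integrable_const C)
    (Filter.Eventually.of_forall fun u t _ => hderiv t u)).2
  filter_upwards [ae_mem_sphere d] with u hu t ht
  exact hC (t, u) ⟨ht, by simpa using hu⟩

/-- The reflection changing the sign of the `j`-th coordinate. -/
noncomputable def coordReflection {d : ℕ} (j : Fin d) :
    EuclideanSpace ℝ (Fin d) ≃ₗᵢ[ℝ] EuclideanSpace ℝ (Fin d) :=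
  LinearIsometryEquiv.piLpCongrRight 2 fun k =>
    if k = j then LinearIsometryEquiv.neg ℝ else LinearIsometryEquiv.refl ℝ ℝ

theorem integral_monomial_eq_zero_of_odd {d : ℕ} (n : Fin d → ℕ) {j : Fin d} (hj : Odd (n j)) :
    ∫ u, ∏ k, u k ^ n k ∂sphereMeasure d = 0 := by
  have h := integral_sphereMeasure_comp (coordReflection j) fun u => ∏ k, u k ^ n k
  have hneg : ∀ u : EuclideanSpace ℝ (Fin d),
      ∏ k, (coordReflection j u) k ^ n k = -∏ k, u k ^ n k := by
    intro u
    rw [← Finset.mul_prod_erase _ _ (Finset.mem_univ j),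
      ← Finset.mul_prod_erase _ (fun k => u k ^ n k) (Finset.mem_univ j), ← neg_mul]
    congr 1
    · simp [coordReflection, hj.neg_pow]
    · refine Finset.prod_congr rfl fun k hk => ?_
      simp [coordReflection, Finset.ne_of_mem_erase hk]
  simp only [hneg, integral_neg] at h
  linarith

theorem sum_eq_add_add_sum_erase {d : ℕ} {i j : Fin d} (hij : i ≠ j) (f : Fin d → ℝ) :
    ∑ k, f k = f i + (f j + ∑ k ∈ (Finset.univ.erase i).erase j, f k) := by
  rw [Finset.add_sum_erase _ f (by simp [hij.symm]), Finset.add_sum_erase _ f (by simp)]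

theorem prod_eq_mul_mul_prod_erase {d : ℕ} {i j : Fin d} (hij : i ≠ j) (f : Fin d → ℝ) :
    ∏ k, f k = f i * (f j * ∏ k ∈ (Finset.univ.erase i).erase j, f k) := by
  rw [Finset.mul_prod_erase _ f (by simp [hij.symm]), Finset.mul_prod_erase _ f (by simp)]

/-- The rotation by the angle `θ` in the plane of the coordinates `i` and `j`. -/
noncomputable def planeRotation {d : ℕ} {i j : Fin d} (hij : i ≠ j) (θ : ℝ) :
    EuclideanSpace ℝ (Fin d) ≃ₗᵢ[ℝ] EuclideanSpace ℝ (Fin d) :=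
  LinearIsometry.toLinearIsometryEquiv
    { toFun := fun u => WithLp.toLp 2 fun k =>
        if k = i then Real.cos θ * u i - Real.sin θ * u j
        else if k = j then Real.sin θ * u i + Real.cos θ * u j else u k
      map_add' := fun u v => by
        ext k
        simp only [PiLp.add_apply]
        split_ifs <;> ring
      map_smul' := fun c u => by
        ext k
        simp only [PiLp.smul_apply, smul_eq_mul, RingHom.id_apply]
        split_ifs <;> ring
      norm_map' := fun u => by
        simp only [LinearMap.coe_mk, AddHom.coe_mk, EuclideanSpace.norm_eq, Real.norm_eq_abs,
          sq_abs]
        congr 1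
        rw [sum_eq_add_add_sum_erase hij, sum_eq_add_add_sum_erase hij fun k => u k ^ 2,
          ← add_assoc, ← add_assoc]
        congr 1
        · simp only [if_pos, if_neg hij.symm]
          linear_combination (u i ^ 2 + u j ^ 2) * Real.sin_sq_add_cos_sq θ
        · refine Finset.sum_congr rfl fun k hk => ?_
          simp only [Finset.mem_erase] at hk
          simp [hk.1, hk.2.1] }
    rfl

theorem planeRotation_apply {d : ℕ} {i j : Fin d} (hij : i ≠ j) (θ : ℝ)
    (u : EuclideanSpace ℝ (Fin d)) (k : Fin d) :
    planeRotation hij θ u k =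
      if k = i then Real.cos θ * u i - Real.sin θ * u j
        else if k = j then Real.sin θ * u i + Real.cos θ * u j else u k :=
  rfl

/-- Differentiating the rotation invariance of a moment at the angle `0`. -/
theorem integral_rotation_deriv_eq_zero {d : ℕ} {i j : Fin d} (hij : i ≠ j) (n : Fin d → ℕ) :
    ∫ u, ((n j + 1 : ℝ) * (u i ^ 2 * ∏ k, u k ^ n k) -
      (n i + 1 : ℝ) * (u j ^ 2 * ∏ k, u k ^ n k)) ∂sphereMeasure d = 0 := by
  have hd : d ≠ 0 := fun h => (h ▸ i).elim0
  let h : EuclideanSpace ℝ (Fin d) → ℝ := fun u =>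
    ∏ k ∈ (Finset.univ.erase i).erase j, u k ^ n k
  have hh : Continuous h := by fun_prop
  let X : ℝ → EuclideanSpace ℝ (Fin d) → ℝ := fun θ u => Real.cos θ * u i - Real.sin θ * u j
  let Y : ℝ → EuclideanSpace ℝ (Fin d) → ℝ := fun θ u => Real.sin θ * u i + Real.cos θ * u j
  let F : ℝ → EuclideanSpace ℝ (Fin d) → ℝ := fun θ u =>
    X θ u ^ (n i + 1) * Y θ u ^ (n j + 1) * h u
  let F' : ℝ → EuclideanSpace ℝ (Fin d) → ℝ := fun θ u =>
    ((n i + 1 : ℝ) * X θ u ^ n i * (-Y θ u) * Y θ u ^ (n j + 1) +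
      X θ u ^ (n i + 1) * ((n j + 1 : ℝ) * Y θ u ^ n j * X θ u)) * h u
  have hF (θ : ℝ) : Continuous (F θ) := by fun_prop
  have hF' : Continuous fun p : ℝ × EuclideanSpace ℝ (Fin d) => F' p.1 p.2 := by fun_prop
  have hderiv (θ : ℝ) (u : EuclideanSpace ℝ (Fin d)) :
      HasDerivAt (fun θ => F θ u) (F' θ u) θ := by
    have hX : HasDerivAt (fun θ => X θ u) (-Y θ u) θ :=
      (((Real.hasDerivAt_cos θ).mul_const (u i)).sub
        ((Real.hasDerivAt_sin θ).mul_const (u j))).congr_deriv (by simp only [Y]; ring)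
    have hY : HasDerivAt (fun θ => Y θ u) (X θ u) θ :=
      (((Real.hasDerivAt_sin θ).mul_const (u i)).add
        ((Real.hasDerivAt_cos θ).mul_const (u j))).congr_deriv (by simp only [X]; ring)
    exact (((hX.pow (n i + 1)).mul (hY.pow (n j + 1))).mul_const (h u)).congr_deriv (by simp [F'])
  have hconst (θ : ℝ) : ∫ u, F θ u ∂sphereMeasure d = ∫ u, F 0 u ∂sphereMeasure d := by
    rw [← integral_sphereMeasure_comp (planeRotation hij θ) (F 0)]
    refine integral_congr_ae (Filter.Eventually.of_forall fun u => ?_)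
    have hhθ : h (planeRotation hij θ u) = h u := by
      refine Finset.prod_congr rfl fun k hk => ?_
      simp only [Finset.mem_erase] at hk
      simp [planeRotation_apply, hk.1, hk.2.1]
    simp [F, X, Y, hhθ, planeRotation_apply, hij.symm]
  have key := hasDerivAt_integral_sphereMeasure hd hF hF' hderiv 0
  simp only [hconst] at key
  rw [← key.unique (hasDerivAt_const _ _)]
  refine integral_congr_ae (Filter.Eventually.of_forall fun u => ?_)
  simp only [F', X, Y, h, Real.cos_zero, Real.sin_zero,
    prod_eq_mul_mul_prod_erase hij fun k => u k ^ n k]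
  ring

theorem integral_sq_mul_monomial_comm {d : ℕ} (i j : Fin d) (n : Fin d → ℕ) :
    (n j + 1 : ℝ) * ∫ u, u i ^ 2 * ∏ k, u k ^ n k ∂sphereMeasure d =
      (n i + 1 : ℝ) * ∫ u, u j ^ 2 * ∏ k, u k ^ n k ∂sphereMeasure d := by
  rcases eq_or_ne i j with rfl | hij
  · rfl
  have hd : d ≠ 0 := fun h => (h ▸ i).elim0
  have h := integral_rotation_deriv_eq_zero hij n
  rw [integral_sub (integrable_sphereMeasure hd (by fun_prop))
    (integrable_sphereMeasure hd (by fun_prop)), integral_const_mul, integral_const_mul] at h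
  linarith

theorem integral_sq_mul_monomial {d : ℕ} (i : Fin d) (n : Fin d → ℕ) :
    ((∑ k, n k + d : ℕ) : ℝ) * ∫ u, u i ^ 2 * ∏ k, u k ^ n k ∂sphereMeasure d =
      (n i + 1 : ℝ) * ∫ u, ∏ k, u k ^ n k ∂sphereMeasure d := by
  have hd : d ≠ 0 := fun h => (h ▸ i).elim0
  have hsum : ∑ j, ∫ u, u j ^ 2 * ∏ k, u k ^ n k ∂sphereMeasure d =
      ∫ u, ∏ k, u k ^ n k ∂sphereMeasure d := by
    rw [← integral_finsetSum _ fun j _ => integrable_sphereMeasure hd (by fun_prop)]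
    refine integral_congr_ae ?_
    filter_upwards [ae_mem_sphere d] with u hu
    have : ∑ j, u j ^ 2 = 1 := by
      rw [← EuclideanSpace.real_norm_sq_eq, hu, one_pow]
    rw [← Finset.sum_mul, this, one_mul]
  rw [← hsum, Finset.mul_sum, ← Finset.sum_congr rfl fun j _ =>
    integral_sq_mul_monomial_comm i j n, ← Finset.sum_mul]
  simp [Finset.sum_add_distrib]

theorem Nat.doubleFactorial_add_one_eq (a : ℕ) :
    Nat.doubleFactorial (a + 1) = (a + 1) * Nat.doubleFactorial (a - 1) := by
  cases a <;> simp [Nat.doubleFactorial]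

theorem integral_monomial_of_even {d : ℕ} (hd : 2 ≤ d) (n : Fin d → ℕ) (hn : ∀ j, Even (n j)) :
    (Nat.doubleFactorial ((∑ j, n j) + d - 2) : ℝ) * ∫ u, ∏ k, u k ^ n k ∂sphereMeasure d =
      (sphereMeasure d).real univ *
        ((Nat.doubleFactorial (d - 2) : ℝ) * ∏ j, (Nat.doubleFactorial (n j - 1) : ℝ)) := by
  induction hN : ∑ j, n j using Nat.strong_induction_on generalizing n with
  | _ N ih =>
  by_cases h0 : ∀ j, n j = 0
  · have : N = 0 := by simp [← hN, h0]
    simp [h0, this, mul_comm]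
  push Not at h0
  obtain ⟨i, hi⟩ := h0
  obtain ⟨a, ha⟩ : ∃ a, n i = a + 2 := ⟨n i - 2, by have := hn i; grind⟩
  let m : Fin d → ℕ := Function.update n i a
  have hmi : m i = a := Function.update_self ..
  have hmk (k : Fin d) (hk : k ≠ i) : m k = n k := Function.update_of_ne hk ..
  have hsum : N = ∑ k, m k + 2 := by
    rw [← hN, ← Finset.add_sum_erase _ _ (Finset.mem_univ i),
      ← Finset.add_sum_erase _ m (Finset.mem_univ i), hmi, ha,
      Finset.sum_congr rfl fun k hk => hmk k (Finset.ne_of_mem_erase hk)]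
    ring
  have hmon (u : EuclideanSpace ℝ (Fin d)) :
      ∏ k, u k ^ n k = u i ^ 2 * ∏ k, u k ^ m k := by
    rw [← Finset.mul_prod_erase _ _ (Finset.mem_univ i),
      ← Finset.mul_prod_erase _ (fun k => u k ^ m k) (Finset.mem_univ i), hmi, ha,
      Finset.prod_congr rfl fun k hk => by rw [← hmk k (Finset.ne_of_mem_erase hk)]]
    ring
  have hfac : ∏ j, (Nat.doubleFactorial (n j - 1) : ℝ) =
      (m i + 1) * ∏ j, (Nat.doubleFactorial (m j - 1) : ℝ) := by
    rw [← Finset.mul_prod_erase _ _ (Finset.mem_univ i),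
      ← Finset.mul_prod_erase _ (fun k => (Nat.doubleFactorial (m k - 1) : ℝ))
        (Finset.mem_univ i), hmi, ha,
      Finset.prod_congr rfl fun k hk => by rw [← hmk k (Finset.ne_of_mem_erase hk)],
      show a + 2 - 1 = a + 1 from rfl, Nat.doubleFactorial_add_one_eq]
    push_cast
    ring
  have hmeven (k : Fin d) : Even (m k) := by
    rcases eq_or_ne k i with rfl | hk
    · have := hn k
      rw [hmi]
      grind
    · rw [hmk k hk]
      exact hn k
  have hdf : Nat.doubleFactorial (N + d - 2) =
      (∑ k, m k + d) * Nat.doubleFactorial (∑ k, m k + d - 2) := by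
    obtain ⟨b, hb⟩ : ∃ b, ∑ k, m k + d = b + 1 := ⟨∑ k, m k + d - 1, by lia⟩
    rw [show N + d - 2 = ∑ k, m k + d by lia, hb, Nat.doubleFactorial_add_one_eq]
    rfl
  have hm := ih (∑ k, m k) (by lia) m hmeven rfl
  have hrec := integral_sq_mul_monomial i m
  simp only [hmon]
  rw [hfac, hdf, Nat.cast_mul]
  linear_combination (Nat.doubleFactorial (∑ k, m k + d - 2) : ℝ) * hrec + (m i + 1 : ℝ) * hm

/-- Let `d ≥ 2` and `n_1, …, n_d ∈ ℕ`. If all `n_j` are even then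
`(1/σ(S^{d−1})) ∫_{S^{d−1}} Π_j u_j^{n_j} dσ(u)
   = ((d−2)!!·Π_j (n_j−1)!!)/((n_1+…+n_d)+d−2)!!`,
and if some `n_j` is odd then `∫_{S^{d−1}} Π_j u_j^{n_j} dσ(u) = 0`, where `σ` is the
`(d−1)`-dimensional Hausdorff measure on the unit sphere of `ℝ^d`. -/
theorem stmt_17 (d : ℕ) (hd : 2 ≤ d) (n : Fin d → ℕ) :
    ((∀ j, Even (n j)) →
      (1 / (μH[(d : ℝ) - 1] (Metric.sphere (0 : EuclideanSpace ℝ (Fin d)) 1)).toReal) *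
          ∫ u in Metric.sphere (0 : EuclideanSpace ℝ (Fin d)) 1,
            (∏ j, u j ^ n j) ∂μH[(d : ℝ) - 1]
        = ((Nat.doubleFactorial (d - 2) : ℝ) * ∏ j, (Nat.doubleFactorial (n j - 1) : ℝ)) /
            (Nat.doubleFactorial ((∑ j, n j) + d - 2) : ℝ)) ∧
    ((∃ j, Odd (n j)) →
      ∫ u in Metric.sphere (0 : EuclideanSpace ℝ (Fin d)) 1,
          (∏ j, u j ^ n j) ∂μH[(d : ℝ) - 1]
        = 0) := by
  have hd0 : d ≠ 0 := by lia
  refine ⟨fun hn => ?_, fun ⟨j, hj⟩ => integral_monomial_eq_zero_of_odd n hj⟩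
  have hpos := sphereMeasure_real_univ_pos hd0
  have h := integral_monomial_of_even hd n hn
  have hreal : (μH[(d : ℝ) - 1] (sphere (0 : EuclideanSpace ℝ (Fin d)) 1)).toReal =
      (sphereMeasure d).real univ := by
    simp [sphereMeasure, measureReal_def]
  have hfac : (0 : ℝ) < Nat.doubleFactorial ((∑ j, n j) + d - 2) := by
    exact_mod_cast Nat.doubleFactorial_pos _
  rw [hreal, eq_div_iff hfac.ne', one_div, inv_mul_eq_div, div_mul_eq_mul_div,
    div_eq_iff hpos.ne', mul_comm (integral _ _), mul_comm _ ((sphereMeasure d).real univ)]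
  exact h
end

section
/- Let d ≥ 2 be an integer, let n_1, …, n_d be nonnegative even integers with |n|_1 := n_1 + … + n_d, and let g : [0,∞) → ℂ be a measurable function such that s ↦ g(|s|) is Lebesgue integrable on ℝ^d. Then the function s ↦ ( Π_{j=1}^{d} s_j^{n_j} / |s|^{|n|_1} ) · g(|s|) (defined for s ≠ 0) is Lebesgue integrable on ℝ^d and ∫_{ℝ^d} ( Π_{j=1}^{d} s_j^{n_j} / |s|^{|n|_1} ) · g(|s|) ds = ( (d−2)!! · Π_{j=1}^{d} (n_j − 1)!! / ( |n|_1 + d − 2 )!! ) · ∫_{ℝ^d} g(|s|) ds. Moreover, if instead some n_j is odd, the left-hand integral equals 0. -/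
open MeasureTheory Set Metric Module
open scoped Nat

/-- Integration in polar coordinates of the product of a function that is homogeneous of degree
zero and a radial function. -/
lemma integral_homogeneous_smul_fun_norm_addHaar {E F : Type*} [NormedAddCommGroup E]
    [NormedSpace ℝ E] [MeasurableSpace E] [FiniteDimensional ℝ E] [BorelSpace E]
    [NormedAddCommGroup F] [NormedSpace ℝ F] (μ : Measure E) [Nontrivial E]
    [μ.IsAddHaarMeasure] (p : E → ℝ) (hp : ∀ x, x ≠ 0 → p (‖x‖⁻¹ • x) = p x) (f : ℝ → F) :
    ∫ x, p x • f ‖x‖ ∂μ = (∫ u : sphere (0 : E) 1, p u ∂μ.toSphere) •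
      ∫ y in Ioi (0 : ℝ), y ^ (finrank ℝ E - 1) • f y :=
  calc
    ∫ x, p x • f ‖x‖ ∂μ
      = ∫ x : ({(0)}ᶜ : Set E), p (‖x.1‖⁻¹ • x.1) • f ‖x.1‖ ∂(μ.comap (↑)) := by
      rw [integral_subtype_comap (measurableSet_singleton _).compl
        fun x ↦ p (‖x‖⁻¹ • x) • f ‖x‖,
        setIntegral_congr_fun (g := fun x ↦ p x • f ‖x‖) (measurableSet_singleton _).compl
        fun x hx ↦ by simp only [hp x hx], restrict_compl_singleton]
    _ = ∫ x, p x.1 • f x.2 ∂μ.toSphere.prod (.volumeIoiPow (finrank ℝ E - 1)) := by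
      simpa using μ.measurePreserving_homeomorphUnitSphereProd.integral_comp
        (Homeomorph.measurableEmbedding _) (fun x ↦ p x.1 • f x.2)
    _ = (∫ u : sphere (0 : E) 1, p u ∂μ.toSphere) •
          ∫ x : Ioi (0 : ℝ), f x ∂.volumeIoiPow (finrank ℝ E - 1) :=
      integral_prod_smul (fun u : sphere (0 : E) 1 ↦ p u) (fun x : Ioi (0 : ℝ) ↦ f x)
    _ = _ := by
      simp only [Measure.volumeIoiPow, ENNReal.ofReal]
      rw [integral_withDensity_eq_integral_smul,
        integral_subtype_comap measurableSet_Ioi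
          fun a ↦ Real.toNNReal (a ^ (finrank ℝ E - 1)) • f a,
        setIntegral_congr_fun measurableSet_Ioi fun x hx ↦ ?_]
      · rw [NNReal.smul_def, Real.coe_toNNReal _ (pow_nonneg hx.out.le _)]
      · exact (measurable_subtype_coe.pow_const _).real_toNNReal

lemma integral_Ioi_pow_mul_exp_neg_sq (n : ℕ) :
    ∫ x in Ioi (0 : ℝ), x ^ n * Real.exp (-x ^ 2) = 1 / 2 * Real.Gamma ((n + 1) / 2) := by
  have h := integral_rpow_mul_exp_neg_rpow (p := 2) (q := n) two_pos
    (by linarith [n.cast_nonneg (α := ℝ)])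
  simpa only [Real.rpow_natCast, Real.rpow_ofNat] using h

lemma integral_pow_mul_exp_neg_sq_of_even {n : ℕ} (hn : Even n) :
    ∫ x : ℝ, x ^ n * Real.exp (-x ^ 2) = Real.Gamma ((n + 1) / 2) := by
  have h := integral_comp_abs (f := fun x : ℝ ↦ x ^ n * Real.exp (-x ^ 2))
  simp only [hn.pow_abs, sq_abs] at h
  rw [h, integral_Ioi_pow_mul_exp_neg_sq]
  ring

lemma integral_pow_mul_exp_neg_sq_of_odd {n : ℕ} (hn : Odd n) :
    ∫ x : ℝ, x ^ n * Real.exp (-x ^ 2) = 0 := by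
  have h := integral_neg_eq_self (fun x : ℝ ↦ x ^ n * Real.exp (-x ^ 2)) volume
  simp only [hn.neg_pow, even_two.neg_pow, neg_mul, integral_neg] at h
  linarith

lemma Gamma_half_add_nat_mul_doubleFactorial {m : ℕ} (hm : 1 ≤ m) (k : ℕ) :
    Real.Gamma (m / 2 + k) * ((m - 2)‼ * 2 ^ k) = Real.Gamma (m / 2) * (2 * k + m - 2)‼ := by
  have hm' : (1 : ℝ) ≤ m := by exact_mod_cast hm
  induction k with
  | zero => simp
  | succ k ih =>
    have h : (2 * (k + 1) + m - 2)‼ = (2 * k + m) * (2 * k + m - 2)‼ := by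
      rcases Nat.exists_eq_add_of_le hm with ⟨l, rfl⟩
      rw [show 2 * (k + 1) + (1 + l) - 2 = 2 * k + l + 1 by omega,
        Nat.doubleFactorial_add_one, show 2 * k + (1 + l) - 2 = 2 * k + l - 1 by omega]
      ring
    rw [h, Nat.cast_succ, ← add_assoc, Real.Gamma_add_one (by positivity)]
    push_cast
    linear_combination (2 * k + m : ℝ) * ih

section Monomial

variable {d : ℕ} (n : Fin d → ℕ)

lemma integral_prod_pow_mul_exp_neg_norm_sq :
    ∫ s : EuclideanSpace ℝ (Fin d), (∏ j, s j ^ n j) * Real.exp (-‖s‖ ^ 2) =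
      ∏ j, ∫ x : ℝ, x ^ n j * Real.exp (-x ^ 2) := by
  rw [← integral_fintype_prod_volume_eq_prod,
    ← (PiLp.volume_preserving_toLp (Fin d)).integral_comp
      (MeasurableEquiv.toLp 2 (Fin d → ℝ)).measurableEmbedding]
  congr! 2 with s
  simp [Finset.prod_mul_distrib, EuclideanSpace.norm_sq_eq, ← Real.exp_sum]

lemma prod_pow_div_norm_pow_smul {s : EuclideanSpace ℝ (Fin d)} (hs : s ≠ 0) :
    (∏ j, (‖s‖⁻¹ • s) j ^ n j) / ‖‖s‖⁻¹ • s‖ ^ (∑ j, n j) =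
      (∏ j, s j ^ n j) / ‖s‖ ^ (∑ j, n j) := by
  have h : ‖s‖ ≠ 0 := norm_ne_zero_iff.2 hs
  simp [norm_smul, h, mul_pow, Finset.prod_mul_distrib, Finset.prod_pow_eq_pow_sum,
    div_eq_inv_mul]

lemma abs_prod_pow_div_norm_pow_le_one (s : EuclideanSpace ℝ (Fin d)) :
    |(∏ j, s j ^ n j) / ‖s‖ ^ (∑ j, n j)| ≤ 1 := by
  rw [abs_div, abs_of_nonneg (pow_nonneg (norm_nonneg s) _)]
  refine div_le_one_of_le₀ ?_ (by positivity)
  rw [Finset.abs_prod, ← Finset.prod_pow_eq_pow_sum]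
  refine Finset.prod_le_prod (fun _ _ ↦ abs_nonneg _) fun j _ ↦ ?_
  rw [abs_pow]
  gcongr
  exact PiLp.norm_apply_le s j

/-- The integral of a monomial over the unit sphere, in terms of Gaussian moments. -/
lemma integral_sphere_prod_pow_mul_Gamma (hd : 1 ≤ d) :
    (∫ u : sphere (0 : EuclideanSpace ℝ (Fin d)) 1,
        (∏ j, u.1 j ^ n j) / ‖u.1‖ ^ (∑ j, n j) ∂(volume : Measure _).toSphere) *
      (1 / 2 * Real.Gamma (((∑ j, n j : ℕ) + d) / 2)) =
      ∏ j, ∫ x : ℝ, x ^ n j * Real.exp (-x ^ 2) := by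
  have : Nonempty (Fin d) := ⟨⟨0, hd⟩⟩
  rw [← integral_prod_pow_mul_exp_neg_norm_sq]
  have h := integral_homogeneous_smul_fun_norm_addHaar
    (volume : Measure (EuclideanSpace ℝ (Fin d)))
    (fun s ↦ (∏ j, s j ^ n j) / ‖s‖ ^ (∑ j, n j))
    (fun s hs ↦ prod_pow_div_norm_pow_smul n hs)
    (fun r ↦ r ^ (∑ j, n j) * Real.exp (-r ^ 2))
  have hcancel (s : EuclideanSpace ℝ (Fin d)) :
      (∏ j, s j ^ n j) / ‖s‖ ^ (∑ j, n j) * ‖s‖ ^ (∑ j, n j) = ∏ j, s j ^ n j := by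
    rcases eq_or_ne s 0 with rfl | hs
    · simp only [PiLp.zero_apply, Finset.prod_pow_eq_pow_sum, norm_zero]
      exact div_mul_cancel_of_imp id
    · exact div_mul_cancel₀ _ (pow_ne_zero _ (norm_ne_zero_iff.2 hs))
  simp only [smul_eq_mul, ← mul_assoc, hcancel, ← pow_add, finrank_euclideanSpace_fin,
    integral_Ioi_pow_mul_exp_neg_sq] at h
  rw [h, mul_assoc]
  congr 4
  push_cast [Nat.cast_sub hd]
  ring

end Monomial

/-- Let `d ≥ 2`, `n_1, …, n_d ∈ ℕ`, and let `g : [0,∞) → ℂ` be measurable with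
`s ↦ g(|s|)` integrable on `ℝ^d`. If all `n_j` are even then
`s ↦ (Π_j s_j^{n_j}/|s|^{|n|₁})·g(|s|)` is integrable on `ℝ^d` and
`∫ (Π_j s_j^{n_j}/|s|^{|n|₁})·g(|s|) ds
   = ((d−2)!!·Π_j (n_j−1)!!/(|n|₁+d−2)!!)·∫ g(|s|) ds`;
if instead some `n_j` is odd, the left-hand integral equals `0`. -/
theorem stmt_18 (d : ℕ) (hd : 2 ≤ d) (n : Fin d → ℕ)
    (g : {x : ℝ // 0 ≤ x} → ℂ) (hg : Measurable g)
    (hint : Integrable (fun s : EuclideanSpace ℝ (Fin d) => g ⟨‖s‖, norm_nonneg s⟩)) :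
    ((∀ j, Even (n j)) →
      Integrable (fun s : EuclideanSpace ℝ (Fin d) =>
        ((∏ j, s j ^ n j) / ‖s‖ ^ (∑ j, n j) : ℝ) • g ⟨‖s‖, norm_nonneg s⟩) ∧
      ∫ s : EuclideanSpace ℝ (Fin d),
          ((∏ j, s j ^ n j) / ‖s‖ ^ (∑ j, n j) : ℝ) • g ⟨‖s‖, norm_nonneg s⟩
        = (((Nat.doubleFactorial (d - 2) : ℝ) *
              ∏ j, (Nat.doubleFactorial (n j - 1) : ℝ)) /
            (Nat.doubleFactorial ((∑ j, n j) + d - 2) : ℝ)) •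
            ∫ s : EuclideanSpace ℝ (Fin d), g ⟨‖s‖, norm_nonneg s⟩) ∧
    ((∃ j, Odd (n j)) →
      ∫ s : EuclideanSpace ℝ (Fin d),
          ((∏ j, s j ^ n j) / ‖s‖ ^ (∑ j, n j) : ℝ) • g ⟨‖s‖, norm_nonneg s⟩
        = 0) := by
  have : Nonempty (Fin d) := ⟨⟨0, by omega⟩⟩
  have polar (m : Fin d → ℕ) := integral_homogeneous_smul_fun_norm_addHaar
    (volume : Measure (EuclideanSpace ℝ (Fin d)))
    (fun s ↦ (∏ j, s j ^ m j) / ‖s‖ ^ (∑ j, m j))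
    (fun s hs ↦ prod_pow_div_norm_pow_smul m hs)
    (fun r ↦ g ⟨max r 0, le_max_right r 0⟩)
  simp only [norm_nonneg, max_eq_left] at polar
  have sphere_integral (m : Fin d → ℕ) := integral_sphere_prod_pow_mul_Gamma m (by omega)
  have hΓ (m : Fin d → ℕ) : Real.Gamma (((∑ j, m j : ℕ) + d) / 2) ≠ 0 :=
    (Real.Gamma_pos_of_pos (by positivity)).ne'
  refine ⟨fun hn ↦ ⟨?_, ?_⟩, fun ⟨j, hj⟩ ↦ ?_⟩
  · have hmeas : Measurable fun s : EuclideanSpace ℝ (Fin d) ↦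
        (∏ j, s j ^ n j) / ‖s‖ ^ (∑ j, n j) := by
      fun_prop
    refine hint.mono (hmeas.aestronglyMeasurable.smul hint.aestronglyMeasurable)
      (.of_forall fun s ↦ ?_)
    rw [norm_smul]
    exact mul_le_of_le_one_left (norm_nonneg _) (abs_prod_pow_div_norm_pow_le_one n s)
  · choose k hk using hn
    have hsum : ∑ j, n j = 2 * ∑ j, k j := by
      simp only [hk, ← two_mul, Finset.mul_sum]
    have hn := sphere_integral n
    have h0 := sphere_integral 0
    have total := polar 0
    simp only [Pi.zero_apply, pow_zero, Finset.prod_const_one, Finset.sum_const_zero, div_one,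
      one_smul] at total h0
    rw [polar n, total, smul_smul]
    congr 1
    simp only [fun j ↦ integral_pow_mul_exp_neg_sq_of_even (⟨k j, hk j⟩ : Even (n j))] at hn
    have hpow := integral_pow_mul_exp_neg_sq_of_even (n := 0) (by simp)
    simp only [pow_zero, Nat.cast_zero, zero_add] at hpow
    simp only [hpow] at h0
    have hone (j : Fin d) : Real.Gamma ((n j + 1) / 2) * 2 ^ k j =
        Real.Gamma (1 / 2) * (n j - 1)‼ := by
      have h := Gamma_half_add_nat_mul_doubleFactorial le_rfl (k j)
      rw [show 2 * k j + 1 - 2 = n j - 1 by have := hk j; omega] at h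
      rw [show ((1 : ℕ) / 2 + k j : ℝ) = (n j + 1) / 2 by rw [hk j]; push_cast; ring] at h
      simpa using h
    have hprod := Finset.prod_congr rfl fun j (_ : j ∈ Finset.univ) ↦ hone j
    rw [Finset.prod_mul_distrib, Finset.prod_mul_distrib, Finset.prod_pow_eq_pow_sum] at hprod
    have hdim := Gamma_half_add_nat_mul_doubleFactorial (by omega : 1 ≤ d) (∑ j, k j)
    rw [← hsum, show (d / 2 + (∑ j, k j : ℕ) : ℝ) = ((∑ j, n j : ℕ) + d) / 2 by
      rw [hsum]; push_cast; ring] at hdim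
    have hN := hΓ n
    have hD := hΓ 0
    simp only [Pi.zero_apply, Finset.sum_const_zero, Nat.cast_zero, zero_add] at h0 hD
    have hfac : (((∑ j, n j) + d - 2)‼ : ℝ) ≠ 0 := by
      exact_mod_cast (Nat.doubleFactorial_pos _).ne'
    have h2 : (2 : ℝ) ^ (∑ j, k j) ≠ 0 := by positivity
    rw [div_mul_eq_mul_div, eq_div_iff hfac]
    refine mul_right_cancel₀ (mul_ne_zero (mul_ne_zero hN hD) h2) ?_
    linear_combination
      2 * (((∑ j, n j) + d - 2)‼ : ℝ) * Real.Gamma (d / 2) * 2 ^ (∑ j, k j) * hn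
      + 2 * (((∑ j, n j) + d - 2)‼ : ℝ) * Real.Gamma (d / 2) * hprod
      - 2 * (∏ _j : Fin d, Real.Gamma (1 / 2)) * (∏ j, ((n j - 1)‼ : ℝ)) * hdim
      - 2 * ((d - 2)‼ : ℝ) * (∏ j, ((n j - 1)‼ : ℝ)) *
        Real.Gamma (((∑ j, n j : ℕ) + d) / 2) * 2 ^ (∑ j, k j) * h0
  · have h := sphere_integral n
    rw [Finset.prod_eq_zero (Finset.mem_univ j) (integral_pow_mul_exp_neg_sq_of_odd hj)] at h
    rw [polar n, (mul_eq_zero.1 h).resolve_right (mul_ne_zero (by norm_num) (hΓ n)), zero_smul]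
end

section
/- Let d ≥ 2 and n ≥ 1 be integers and let F : (0,∞) → ℝ be a smooth function with F′(α) = α^{−d/2} for all α > 0. Then for every t > 0 and all pairwise distinct α_0, …, α_n > 0: Σ_{j=0}^{n} F(t·α_j)/Π_{l≠j}(t·α_j − t·α_l) = t^{1 − d/2 − n} · Σ_{j=0}^{n} F(α_j)/Π_{l≠j}(α_j − α_l); that is, the n-th divided difference of F is homogeneous of degree 1 − d/2 − n. -/
/-- A divided difference of order at least one annihilates constants. -/
theorem sum_inv_prod_sub_eq_zero {K ι : Type*} [Field K] [DecidableEq ι] {s : Finset ι}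
    {v : ι → K} (hv : Set.InjOn v s) (hs : 1 < s.card) :
    ∑ j ∈ s, (∏ l ∈ s.erase j, (v j - v l))⁻¹ = 0 := by
  have hdeg : (1 : Polynomial K).degree < s.card := by
    rw [Polynomial.degree_one]
    exact_mod_cast zero_lt_one.trans hs
  have h := Lagrange.coeff_eq_sum hv hdeg
  rw [Polynomial.coeff_one, if_neg (by omega)] at h
  simpa using h.symm

/-- An antiderivative of `x ↦ x ^ a` on `(0, ∞)` is homogeneous of degree `a + 1` up to an
additive constant. -/
theorem exists_const_comp_mul_eq_of_hasDerivAt_rpow {F : ℝ → ℝ} {a t : ℝ} (ht : 0 < t)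
    (hF : ∀ x : ℝ, 0 < x → HasDerivAt F (x ^ a) x) :
    ∃ c : ℝ, ∀ x : ℝ, 0 < x → F (t * x) = t ^ (a + 1) * F x + c := by
  have hG : ∀ x : ℝ, 0 < x →
      HasDerivAt (fun y => F (t * y) - t ^ (a + 1) * F y) 0 x := by
    intro x hx
    have h₁ := (hF (t * x) (mul_pos ht hx)).comp x ((hasDerivAt_id x).const_mul t)
    refine (h₁.sub ((hF x hx).const_mul (t ^ (a + 1)))).congr_deriv ?_
    rw [Real.mul_rpow ht.le hx.le, Real.rpow_add_one ht.ne']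
    ring
  obtain ⟨c, hc⟩ := isOpen_Ioi.exists_is_const_of_deriv_eq_zero
    (convex_Ioi (0 : ℝ)).isPreconnected
    (fun x hx => (hG x hx).differentiableAt.differentiableWithinAt)
    (fun x hx => (hG x hx).deriv)
  exact ⟨c, fun x hx => by linarith [hc x hx]⟩

/-- Let `d ≥ 2`, `n ≥ 1`, and let `F` be smooth on `(0,∞)` with
`F′(α) = α^{−d/2}`. Then for every `t > 0` and all pairwise distinct `α_0, …, α_n > 0`:
`Σ_j F(t·α_j)/Π_{l≠j}(t·α_j − t·α_l) = t^{1−d/2−n}·Σ_j F(α_j)/Π_{l≠j}(α_j − α_l)`;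
i.e., the `n`-th divided difference of `F` is homogeneous of degree `1 − d/2 − n`. -/
theorem stmt_19 (d n : ℕ) (hd : 2 ≤ d) (hn : 1 ≤ n) (F : ℝ → ℝ)
    (hFsmooth : ContDiffOn ℝ (⊤ : ℕ∞) F (Set.Ioi 0))
    (hF : ∀ x : ℝ, 0 < x → HasDerivAt F (x ^ (-(d : ℝ) / 2)) x)
    (t : ℝ) (ht : 0 < t) (α : Fin (n + 1) → ℝ) (hpos : ∀ j, 0 < α j)
    (hinj : Function.Injective α) :
    ∑ j, F (t * α j) / ∏ l ∈ Finset.univ.erase j, (t * α j - t * α l)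
      = t ^ (1 - (d : ℝ) / 2 - (n : ℝ)) *
          ∑ j, F (α j) / ∏ l ∈ Finset.univ.erase j, (α j - α l) := by
  obtain ⟨c, hc⟩ := exists_const_comp_mul_eq_of_hasDerivAt_rpow ht hF
  have hzero : ∑ j, (∏ l ∈ Finset.univ.erase j, (α j - α l))⁻¹ = 0 :=
    sum_inv_prod_sub_eq_zero hinj.injOn (by simp; omega)
  have hpow : t ^ (1 - (d : ℝ) / 2 - (n : ℝ)) = t ^ (-(d : ℝ) / 2 + 1) / t ^ n := by
    rw [← Real.rpow_natCast, ← Real.rpow_sub ht]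
    ring_nf
  have hterm : ∀ j, F (t * α j) / ∏ l ∈ Finset.univ.erase j, (t * α j - t * α l)
      = t ^ (1 - (d : ℝ) / 2 - (n : ℝ)) * (F (α j) / ∏ l ∈ Finset.univ.erase j, (α j - α l))
        + c / t ^ n * (∏ l ∈ Finset.univ.erase j, (α j - α l))⁻¹ := by
    intro j
    have hprod : ∏ l ∈ Finset.univ.erase j, (t * α j - t * α l)
        = t ^ n * ∏ l ∈ Finset.univ.erase j, (α j - α l) := by
      simp [← mul_sub, Finset.prod_mul_distrib]
    rw [hprod, hc _ (hpos j), hpow, ← div_div]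
    ring
  rw [Finset.sum_congr rfl fun j _ => hterm j, Finset.sum_add_distrib, ← Finset.mul_sum,
    ← Finset.mul_sum, hzero, mul_zero, add_zero]
end
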